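/- arXiv:2102.12977 — 2 statements merged into one kernel-verified Lean document; each statement's English description precedes it below -/
import Mathlib

section
/- Let p be a prime number with p ≡ 7 (mod 24). Then every rational solution (x, y) ∈ ℚ × ℚ of the equation y² = x(x² − p²)(x² − 4p²) satisfies y = 0 (hence x ∈ {0, p, −p, 2p, −2p}). In other words, the set of rational points of the genus 2 curve C_p consists of only its six Weierstrass points. -/
theorem Int.exists_eq_mul_isCoprime {x y : ℤ} (hx : x ≠ 0) :
    ∃ g a b : ℤ, g ≠ 0 ∧ IsCoprime a b ∧ x = g * a ∧ y = g * b := by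
  have hg : 0 < Int.gcd x y := Int.gcd_pos_of_ne_zero_left _ hx
  obtain ⟨a, b, hab, ha, hb⟩ := Int.exists_gcd_one hg
  exact ⟨Int.gcd x y, a, b, by exact_mod_cast hg.ne', Int.isCoprime_iff_gcd_eq_one.mpr hab,
    by rw [mul_comm]; exact ha, by rw [mul_comm]; exact hb⟩

theorem Int.pos_of_ne_zero_sq {x : ℤ} (hx : x ≠ 0) : 1 ≤ x ^ 2 := by
  have : 0 < x ^ 2 := by positivity
  linarith

theorem Int.exists_sq_and_sq_of_isCoprime_of_mul_eq_sq {x y w : ℤ} (h : IsCoprime x y)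
    (hx : 0 ≤ x) (hy : 0 ≤ y) (hw : x * y = w ^ 2) : (∃ a, x = a ^ 2) ∧ ∃ b, y = b ^ 2 := by
  obtain ⟨a, ha⟩ := Int.sq_of_isCoprime h hw
  obtain ⟨b, hb⟩ := Int.sq_of_isCoprime h.symm (by rw [mul_comm]; exact hw)
  refine ⟨⟨a, ?_⟩, ⟨b, ?_⟩⟩
  · rcases ha with ha | ha
    · exact ha
    · nlinarith [sq_nonneg a]
  · rcases hb with hb | hb
    · exact hb
    · nlinarith [sq_nonneg b]

theorem Int.sq_emod_eight (z : ℤ) :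
    z ^ 2 % 8 = 0 ∧ z % 4 = 0 ∨ z ^ 2 % 8 = 4 ∧ z % 4 = 2 ∨ z ^ 2 % 8 = 1 ∧ z % 2 = 1 := by
  have h : z % 8 = 0 ∨ z % 8 = 1 ∨ z % 8 = 2 ∨ z % 8 = 3 ∨ z % 8 = 4 ∨ z % 8 = 5 ∨ z % 8 = 6 ∨
    z % 8 = 7 := by omega
  rcases h with h | h | h | h | h | h | h | h <;> simp [pow_two, Int.mul_emod, h] <;> omega

theorem add_lt_sq_add_sq_of_ne {b c : ℤ} (hb : 0 < b) (hc : 0 < c) (h : b ≠ c) :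
    b + c < b ^ 2 + c ^ 2 := by
  rcases lt_or_gt_of_ne h with h | h <;> nlinarith

/-- If `a, b, c` are such that `a², b², c²` is an arithmetic progression, with `b` and `c` coprime,
then `b` and `c` are expressed through a parametrization of Pythagorean triples. -/
theorem exists_param_of_sq_add_sq_eq_two_mul_sq {a b c : ℤ} (hbc : IsCoprime b c) (hb : 0 < b)
    (h : a ^ 2 + c ^ 2 = 2 * b ^ 2) :
    ∃ r s : ℤ, b = r ^ 2 + s ^ 2 ∧ c = r ^ 2 - s ^ 2 + 2 * r * s := by
  obtain ⟨x, hx⟩ : ∃ x, c = a + 2 * x := by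
    have := Int.sq_emod_eight a
    have := Int.sq_emod_eight c
    exact ⟨(c - a) / 2, by omega⟩
  subst hx
  have hp : PythagoreanTriple x (a + x) b := by
    unfold PythagoreanTriple; linarith
  have hc : Int.gcd x (a + x) = 1 := by
    rw [← Int.isCoprime_iff_gcd_eq_one]
    obtain ⟨u, v, huv⟩ := (IsCoprime.pow_left (m := 2) hbc)
    have e : b ^ 2 = x * x + (a + x) * (a + x) := by linarith
    rw [e] at huv
    exact ⟨v + u * x, v + u * (a + x), by linear_combination huv⟩
  obtain ⟨r, s, h1, h2, -, -⟩ := PythagoreanTriple.coprime_classification.mp ⟨hp, hc⟩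
  refine ⟨r, s, ?_, ?_⟩
  · rcases h2 with h2 | h2
    · exact h2
    · nlinarith [sq_nonneg r, sq_nonneg s]
  · rcases h1 with ⟨h1, h3⟩ | ⟨h1, h3⟩ <;> linarith

theorem exists_of_two_mul_sq_add_sq_mul_eq_sq {x y w : ℤ} (hxy : IsCoprime x y)
    (h : (2 * x ^ 2 + y ^ 2) * (x ^ 2 + 2 * y ^ 2) = w ^ 2) :
    ∃ e f : ℤ, 2 * x ^ 2 + y ^ 2 = 3 * e ^ 2 ∧ x ^ 2 + 2 * y ^ 2 = 3 * f ^ 2 := by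
  obtain ⟨u, v, huv⟩ := hxy.pow (m := 2) (n := 2)
  by_cases h3 : (3 : ℤ) ∣ 2 * x ^ 2 + y ^ 2
  · obtain ⟨X, hX⟩ := h3
    obtain ⟨Y, hY⟩ : (3 : ℤ) ∣ x ^ 2 + 2 * y ^ 2 := by omega
    obtain ⟨z, hz⟩ : (3 : ℤ) ∣ w := by
      apply Int.prime_three.dvd_of_dvd_pow (n := 2)
      rw [← h, hX, mul_assoc]; exact dvd_mul_right _ _
    have hc : IsCoprime X Y := ⟨2 * u - v, 2 * v - u, by
      have e1 : x ^ 2 = 2 * X - Y := by linarith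
      have e2 : y ^ 2 = 2 * Y - X := by linarith
      rw [e1, e2] at huv
      linear_combination huv⟩
    have hXY : X * Y = z ^ 2 := by
      rw [hX, hY, hz] at h; linarith
    obtain ⟨⟨e, he⟩, ⟨f, hf⟩⟩ := Int.exists_sq_and_sq_of_isCoprime_of_mul_eq_sq hc
      (by nlinarith [sq_nonneg x, sq_nonneg y]) (by nlinarith [sq_nonneg x, sq_nonneg y]) hXY
    exact ⟨e, f, by rw [hX, he], by rw [hY, hf]⟩
  · exfalso
    have hc : IsCoprime (2 * x ^ 2 + y ^ 2) (x ^ 2 + 2 * y ^ 2) := by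
      obtain ⟨a, b, hab⟩ := (Int.prime_three.coprime_iff_not_dvd.mpr h3)
      refine ⟨b + a * (2 * u - v), a * (2 * v - u), ?_⟩
      linear_combination hab + 3 * a * huv
    obtain ⟨⟨e, he⟩, ⟨f, hf⟩⟩ := Int.exists_sq_and_sq_of_isCoprime_of_mul_eq_sq hc
      (by positivity) (by positivity) h
    have h1 := Int.sq_emod_eight x
    have h2 := Int.sq_emod_eight y
    have h4 := Int.sq_emod_eight e
    have h5 := Int.sq_emod_eight f
    have h6 : ¬ (x % 2 = 0 ∧ y % 2 = 0) := by
      rintro ⟨hx, hy⟩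
      have := hxy.isUnit_of_dvd' (Int.dvd_of_emod_eq_zero hx) (Int.dvd_of_emod_eq_zero hy)
      exact absurd this (by decide)
    omega

theorem sq_eq_sq_of_four_sq_arith_prog_aux (N : ℕ) : ∀ a b c d : ℤ, b ^ 2 + c ^ 2 ≤ N →
    0 < b → 0 < c → IsCoprime b c → a ^ 2 + c ^ 2 = 2 * b ^ 2 → b ^ 2 + d ^ 2 = 2 * c ^ 2 →
    b = c := by
  induction N with
  | zero => intro a b c d hN hb hc; exfalso; push_cast at hN; nlinarith
  | succ N ih =>
    intro a b c d hN hb hc hbc h1 h2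
    by_contra hne
    obtain ⟨r, s, hb1, hc1⟩ := exists_param_of_sq_add_sq_eq_two_mul_sq hbc hb h1
    obtain ⟨t, u, hc2, hb2⟩ := exists_param_of_sq_add_sq_eq_two_mul_sq hbc.symm hc
      (by linarith : d ^ 2 + b ^ 2 = 2 * c ^ 2)
    have e1 : s * (s - r) = u * (t - u) := by linarith
    have e2 : r * (r + s) = t * (t + u) := by linarith
    have hs : s ≠ 0 := by
      rintro rfl
      exact hne (by rw [hb1, hc1]; ring)
    obtain ⟨α, β, ⟨γ, hγ⟩, ⟨δ, hδ⟩, hαβ⟩ := exists_dvd_and_dvd_of_dvd_mul (Dvd.intro _ e1)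
    have hα : α ≠ 0 := by rintro rfl; exact hs (by rw [hαβ]; ring)
    have hβ : β ≠ 0 := by rintro rfl; exact hs (by rw [hαβ]; ring)
    have hsr : s - r = γ * δ := by
      apply mul_left_cancel₀ hs
      rw [e1, hδ, hγ, hαβ]; ring
    have hδ0 : δ ≠ 0 := by
      rintro rfl
      have h3 : r = s := by linarith
      have h4 : t = u := by linarith
      subst h3 h4
      exact hne (by linarith)
    have hr : r = α * β - γ * δ := by linarith
    have ht : t = α * γ + β * δ := by linarith
    have key : (2 * (β ^ 2 - γ ^ 2) * α - 3 * β * γ * δ) ^ 2 =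
        δ ^ 2 * ((2 * β ^ 2 + γ ^ 2) * (β ^ 2 + 2 * γ ^ 2)) := by
      rw [hr, ht, hαβ, hγ] at e2
      linear_combination 2 * (β ^ 2 - γ ^ 2) * e2
    obtain ⟨w, hw⟩ : δ ∣ 2 * (β ^ 2 - γ ^ 2) * α - 3 * β * γ * δ := by
      rw [← Int.pow_dvd_pow_iff two_ne_zero, key]
      exact dvd_mul_right _ _
    have hquartic : (2 * β ^ 2 + γ ^ 2) * (β ^ 2 + 2 * γ ^ 2) = w ^ 2 := by
      apply mul_left_cancel₀ (pow_ne_zero 2 hδ0)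
      rw [← key, hw]; ring
    obtain ⟨g, x, y, hg, hxy, rfl, rfl⟩ := Int.exists_eq_mul_isCoprime (y := γ) hβ
    obtain ⟨w, rfl⟩ : g ^ 2 ∣ w := by
      rw [← Int.pow_dvd_pow_iff two_ne_zero, ← hquartic]
      exact ⟨(2 * x ^ 2 + y ^ 2) * (x ^ 2 + 2 * y ^ 2), by ring⟩
    have hxyw : (2 * x ^ 2 + y ^ 2) * (x ^ 2 + 2 * y ^ 2) = w ^ 2 := by
      apply mul_left_cancel₀ (pow_ne_zero 4 hg)
      linear_combination hquartic
    obtain ⟨e, f, he, hf⟩ := exists_of_two_mul_sq_add_sq_mul_eq_sq hxy hxyw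
    have hx : x ≠ 0 := by rintro rfl; simp at hβ
    have hx2 : 0 < x ^ 2 := by positivity
    have he0 : e ≠ 0 := by rintro rfl; nlinarith [sq_nonneg y]
    have hf0 : f ≠ 0 := by rintro rfl; nlinarith [sq_nonneg y]
    have hef : IsCoprime f e := by
      obtain ⟨u, v, huv⟩ := hxy.pow (m := 2) (n := 2)
      have e1 : x ^ 2 = 2 * e ^ 2 - f ^ 2 := by linarith
      have e2 : y ^ 2 = 2 * f ^ 2 - e ^ 2 := by linarith
      rw [e1, e2] at huv
      exact ⟨(2 * v - u) * f, (2 * u - v) * e, by linear_combination huv⟩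
    have hlt : x ^ 2 + y ^ 2 < b ^ 2 + c ^ 2 := by
      have hα2 : 1 ≤ α ^ 2 := Int.pos_of_ne_zero_sq hα
      have hg2 : 1 ≤ g ^ 2 := Int.pos_of_ne_zero_sq hg
      have h3 : 1 ≤ α ^ 2 * g ^ 2 := one_le_mul_of_one_le_of_one_le hα2 hg2
      have h4 : s ^ 2 + u ^ 2 = α ^ 2 * g ^ 2 * (x ^ 2 + y ^ 2) := by
        rw [hαβ, hγ]; ring
      have h5 : x ^ 2 + y ^ 2 ≤ s ^ 2 + u ^ 2 := by
        rw [h4]; exact le_mul_of_one_le_left (by positivity) h3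
      have h6 : s ^ 2 + u ^ 2 ≤ b + c := by linarith [sq_nonneg r, sq_nonneg t]
      linarith [add_lt_sq_add_sq_of_ne hb hc hne]
    have hfe := ih y |f| |e| x (by simp only [sq_abs]; push_cast at hN; linarith)
      (abs_pos.mpr hf0) (abs_pos.mpr he0) ((IsCoprime.abs_abs_iff f e).mpr hef)
      (by simp only [sq_abs]; linarith) (by simp only [sq_abs]; linarith)
    have hfe2 : f ^ 2 = e ^ 2 := by rw [← sq_abs f, hfe, sq_abs]
    have hyx : x ^ 2 = y ^ 2 := by linarith
    have hy : y ≠ 0 := by rintro rfl; simp at hyx; exact hx hyx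
    rw [hr, ht, hαβ, hγ] at e2
    have h0 : 6 * (α * (g * x) * (g * y) * δ) = 0 := by
      linear_combination g ^ 2 * (2 * α ^ 2 - δ ^ 2) * hyx - e2
    simp [hα, hg, hx, hy, hδ0] at h0

/-- **Fermat**: there are no four distinct squares in arithmetic progression. -/
theorem sq_eq_sq_of_four_sq_arith_prog {a b c d : ℤ} (hb : b ≠ 0) (hc : c ≠ 0)
    (hbc : IsCoprime b c) (h1 : a ^ 2 + c ^ 2 = 2 * b ^ 2) (h2 : b ^ 2 + d ^ 2 = 2 * c ^ 2) :
    b ^ 2 = c ^ 2 := by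
  have := sq_eq_sq_of_four_sq_arith_prog_aux (b ^ 2 + c ^ 2).natAbs a |b| |c| d
    (by simp only [sq_abs]; omega) (abs_pos.mpr hb) (abs_pos.mpr hc)
    ((IsCoprime.abs_abs_iff b c).mpr hbc) (by simpa only [sq_abs]) (by simpa only [sq_abs])
  rw [← sq_abs b, this, sq_abs]

/-- The multiplicity of the natural number `q` (meant to be prime) in the integer `x`. -/
def Int.val (q : ℕ) (x : ℤ) : ℕ := x.natAbs.factorization q

namespace Int

theorem val_mul {x y : ℤ} (q : ℕ) (hx : x ≠ 0) (hy : y ≠ 0) :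
    val q (x * y) = val q x + val q y := by
  simp [val, natAbs_mul, Nat.factorization_mul (natAbs_ne_zero.mpr hx) (natAbs_ne_zero.mpr hy)]

theorem val_sq (q : ℕ) (x : ℤ) : val q (x ^ 2) = 2 * val q x := by
  simp [val, natAbs_pow]

theorem val_natCast_prime {p : ℕ} (hp : p.Prime) (q : ℕ) :
    val q (p : ℤ) = if p = q then 1 else 0 := by
  simp [val, hp.factorization, Finsupp.single_apply]

theorem pow_dvd_iff_le_val {q : ℕ} (hq : q.Prime) {x : ℤ} (hx : x ≠ 0) (k : ℕ) :
    (q : ℤ) ^ k ∣ x ↔ k ≤ val q x := by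
  rw [val, ← hq.pow_dvd_iff_le_factorization (natAbs_ne_zero.mpr hx), ← Int.natCast_dvd]
  push_cast; rfl

theorem dvd_iff_one_le_val {q : ℕ} (hq : q.Prime) {x : ℤ} (hx : x ≠ 0) :
    (q : ℤ) ∣ x ↔ 1 ≤ val q x := by
  simpa using pow_dvd_iff_le_val hq hx 1

theorem val_eq_zero {q : ℕ} {x : ℤ} (h : ¬ (q : ℤ) ∣ x) : val q x = 0 :=
  Nat.factorization_eq_zero_of_not_dvd (by rwa [← Int.natCast_dvd])

/-- A nonzero integer is determined up to a square by its sign and the parities of its valuations;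
here only the primes `2`, `3` and `p` occur. -/
theorem exists_abs_eq_mul_sq {p : ℕ} (hp : p.Prime) (hp2 : p ≠ 2) (hp3 : p ≠ 3) {x : ℤ}
    (hx : x ≠ 0) (h : ∀ q : ℕ, q.Prime → q ≠ 2 → q ≠ 3 → q ≠ p → val q x % 2 = 0) :
    ∃ z : ℤ, z ≠ 0 ∧
      |x| = 2 ^ (val 2 x % 2) * 3 ^ (val 3 x % 2) * (p : ℤ) ^ (val p x % 2) * z ^ 2 := by
  obtain ⟨a, b, hab, ha⟩ := Nat.sq_mul_squarefree x.natAbs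
  have hx' := natAbs_ne_zero.mpr hx
  have hb : b ≠ 0 := by rintro rfl; simp at hab; exact hx' hab.symm
  have ha0 := ha.ne_zero
  have hval (q : ℕ) : a.factorization q = val q x % 2 := by
    have h1 := ha.natFactorization_le_one q
    have h2 : val q x = 2 * b.factorization q + a.factorization q := by
      rw [val, ← hab, Nat.factorization_mul (pow_ne_zero 2 hb) ha0, Nat.factorization_pow]
      simp
    omega
  have ha' : a = 2 ^ (val 2 x % 2) * 3 ^ (val 3 x % 2) * p ^ (val p x % 2) := by
    have hpos := hp.pos
    apply Nat.eq_of_factorization_eq ha0 (by positivity)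
    intro q
    rw [Nat.factorization_mul (by positivity) (by positivity),
      Nat.factorization_mul (by positivity) (by positivity), Nat.prime_two.factorization_pow,
      Nat.prime_three.factorization_pow, hp.factorization_pow, hval]
    simp only [Finsupp.add_apply, Finsupp.single_apply]
    by_cases hq : q.Prime
    · by_cases h2 : q = 2
      · subst h2; simp [hp2]
      by_cases h3 : q = 3
      · subst h3; simp [hp3]
      by_cases h4 : q = p
      · subst h4; simp [hp2.symm, hp3.symm]
      · rw [h q hq h2 h3 h4]; simp [Ne.symm h2, Ne.symm h3, Ne.symm h4]
    · have h2 : 2 ≠ q := by rintro rfl; exact hq Nat.prime_two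
      have h3 : 3 ≠ q := by rintro rfl; exact hq Nat.prime_three
      have h4 : p ≠ q := by rintro rfl; exact hq hp
      simp [val, Nat.factorization_eq_zero_of_not_prime _ hq, h2, h3, h4]
  refine ⟨b, by exact_mod_cast hb, ?_⟩
  rw [Int.abs_eq_natAbs, ← hab]
  nth_rewrite 1 [ha']
  push_cast; ring

theorem exists_eq_mul_sq {p : ℕ} (hp : p.Prime) (hp2 : p ≠ 2) (hp3 : p ≠ 3) {x : ℤ}
    (hx : 0 < x) (h : ∀ q : ℕ, q.Prime → q ≠ 2 → q ≠ 3 → q ≠ p → val q x % 2 = 0) {i j k : ℕ}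
    (hi : val 2 x % 2 = i) (hj : val 3 x % 2 = j) (hk : val p x % 2 = k) :
    ∃ z : ℤ, z ≠ 0 ∧ x = 2 ^ i * (3 ^ j * ((p : ℤ) ^ k * z ^ 2)) := by
  obtain ⟨z, hz, hxz⟩ := exists_abs_eq_mul_sq hp hp2 hp3 hx.ne' h
  refine ⟨z, hz, ?_⟩
  rw [abs_of_pos hx, hi, hj, hk] at hxz
  linarith

/-- If a prime divides the values of two linear forms at a coprime pair, it divides the
determinant of the two forms. -/
theorem dvd_det_of_dvd_of_dvd {d m n : ℤ} (hmn : IsCoprime m n) {a b a' b' : ℤ}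
    (h : d ∣ a * m + b * n) (h' : d ∣ a' * m + b' * n) : d ∣ a * b' - a' * b := by
  obtain ⟨u, v, huv⟩ := hmn
  have e : a * b' - a' * b =
      (a * m + b * n) * (u * b' - v * a') + (a' * m + b' * n) * (v * a - u * b) := by
    linear_combination -(a * b' - a' * b) * huv
  rw [e]
  exact dvd_add (h.mul_right _) (h'.mul_right _)

/-- The valuations at a prime of two linear forms evaluated at a coprime pair cannot both be
positive if the prime does not divide the determinant of the forms. -/
theorem val_eq_zero_or_val_eq_zero {q : ℕ} {m n x y : ℤ} (hmn : IsCoprime m n)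
    (a b a' b' : ℤ) (hx : x = a * m + b * n) (hy : y = a' * m + b' * n)
    (h : ¬ (q : ℤ) ∣ a * b' - a' * b) : val q x = 0 ∨ val q y = 0 := by
  by_contra! hc
  have hqx : (q : ℤ) ∣ x := by by_contra h'; exact hc.1 (val_eq_zero h')
  have hqy : (q : ℤ) ∣ y := by by_contra h'; exact hc.2 (val_eq_zero h')
  exact h (dvd_det_of_dvd_of_dvd hmn (hx ▸ hqx) (hy ▸ hqy))

end Int

namespace legendreSym

variable {p : ℕ} [Fact p.Prime]

theorem neg_one_of_seven_mod (h : p % 24 = 7) : legendreSym p (-1) = -1 := by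
  rw [legendreSym.at_neg_one (by omega), ZMod.χ₄_nat_mod_four, show p % 4 = 3 by omega]; rfl

theorem two_of_seven_mod (h : p % 24 = 7) : legendreSym p 2 = 1 := by
  rw [legendreSym.at_two (by omega), ZMod.χ₈_nat_mod_eight, show p % 8 = 7 by omega]; rfl

theorem three_of_seven_mod (h : p % 24 = 7) : legendreSym p 3 = -1 := by
  have h1 := legendreSym.quadratic_reciprocity_three_mod_four (p := 3) (q := p) (by norm_num)
    (by omega)
  rw [legendreSym.mod 3, show (p : ℤ) % (3 : ℕ) = 1 by push_cast; omega, legendreSym.at_one] at h1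
  exact_mod_cast h1

theorem eq_mul_of_dvd_sub {c x y : ℤ} (h : (p : ℤ) ∣ x - c * y) :
    legendreSym p x = legendreSym p c * legendreSym p y := by
  rw [← legendreSym.mul, legendreSym.mod p x, legendreSym.mod p (c * y),
    (Int.emod_eq_emod_iff_emod_sub_eq_zero.mpr (Int.emod_eq_zero_of_dvd h))]

theorem eq_sign_mul_of_seven_mod (h : p % 24 = 7) {x : ℤ}
    (hq : ∀ q : ℕ, q.Prime → q ≠ 2 → q ≠ 3 → q ≠ p → Int.val q x % 2 = 0) (hpx : ¬ (p : ℤ) ∣ x) :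
    legendreSym p x = x.sign * (-1) ^ (Int.val 3 x % 2) := by
  have hx : x ≠ 0 := by rintro rfl; exact hpx (dvd_zero _)
  obtain ⟨z, -, hz⟩ := Int.exists_abs_eq_mul_sq Fact.out (by omega) (by omega) hx hq
  have hpow (a : ℤ) (n : ℕ) : legendreSym p (a ^ n) = legendreSym p a ^ n :=
    map_pow (legendreSym.hom p) a n
  have hpz : ((z : ℤ) : ZMod p) ≠ 0 := by
    rw [Ne, ZMod.intCast_zmod_eq_zero_iff_dvd]
    intro hd
    apply hpx
    rw [← dvd_abs, hz]
    exact dvd_mul_of_dvd_right (dvd_pow hd two_ne_zero) _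
  have habs : legendreSym p |x| = (-1) ^ (Int.val 3 x % 2) := by
    rw [hz, Int.val_eq_zero hpx, legendreSym.mul, legendreSym.mul, legendreSym.mul,
      legendreSym.sq_one' p hpz, hpow, hpow, two_of_seven_mod h, three_of_seven_mod h]
    simp
  have hs : x = x.sign * |x| := (Int.sign_mul_abs x).symm
  rw [hs, legendreSym.mul, habs, ← hs]
  rcases lt_or_gt_of_ne hx with h0 | h0
  · rw [Int.sign_eq_neg_one_of_neg h0, neg_one_of_seven_mod h]
  · rw [Int.sign_eq_one_of_pos h0, legendreSym.at_one]

end legendreSym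

set_option maxHeartbeats 1000000 in
/-- One step of the `2`-descent on the congruent number curve of `6 * p`. -/
theorem exists_of_mul_mul_mul_eq_six_mul_prime {p : ℕ} (hp : p.Prime) (hmod : p % 24 = 7)
    {m n g : ℤ} (hn : 0 < n) (hnm : n < m) (hmn : IsCoprime m n) (hodd : (m + n) % 2 = 1)
    (h : m * n * (m + n) * (m - n) = 6 * p * g ^ 2) :
    ∃ a f e b : ℤ, f ≠ 0 ∧ m = a ^ 2 ∧ n = 6 * p * f ^ 2 ∧ m + n = e ^ 2 ∧ m - n = b ^ 2 := by
  have := Fact.mk hp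
  have hp2 : p ≠ 2 := by omega
  have hp3 : p ≠ 3 := by omega
  have hm : 0 < m := by linarith
  have hs : 0 < m + n := by linarith
  have hd : 0 < m - n := by linarith
  have hg : g ≠ 0 := by
    rintro rfl
    have : 0 < m * n * (m + n) * (m - n) := by positivity
    simp [h] at this
  have hp0 : (p : ℤ) ≠ 0 := by exact_mod_cast hp.ne_zero
  have hsum (q : ℕ) : Int.val q m + Int.val q n + Int.val q (m + n) + Int.val q (m - n) =
      (if 2 = q then 1 else 0) + (if 3 = q then 1 else 0) + (if p = q then 1 else 0) +
        2 * Int.val q g := by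
    have h' : m * n * (m + n) * (m - n) = ((2 : ℕ) : ℤ) * ((3 : ℕ) : ℤ) * p * g ^ 2 := by
      rw [h]; push_cast; ring
    have := congrArg (Int.val q) h'
    rwa [Int.val_mul q (by positivity) hd.ne', Int.val_mul q (by positivity) hs.ne',
      Int.val_mul q hm.ne' hn.ne', Int.val_mul q (by simp [hp.ne_zero]) (by positivity),
      Int.val_mul q (by simp) hp0, Int.val_mul q (by simp) (by simp), Int.val_sq,
      Int.val_natCast_prime Nat.prime_two, Int.val_natCast_prime Nat.prime_three,
      Int.val_natCast_prime hp] at this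
  have hpair (q : ℕ) (hq : q.Prime) :
      (Int.val q m = 0 ∨ Int.val q n = 0) ∧
      (Int.val q m = 0 ∨ Int.val q (m + n) = 0) ∧
      (Int.val q m = 0 ∨ Int.val q (m - n) = 0) ∧
      (Int.val q n = 0 ∨ Int.val q (m + n) = 0) ∧
      (Int.val q n = 0 ∨ Int.val q (m - n) = 0) ∧
      (Int.val q (m + n) = 0 ∨ Int.val q (m - n) = 0) := by
    have hq1 : ¬ (q : ℤ) ∣ 1 := by
      intro hd
      exact hq.one_lt.ne' (Nat.dvd_one.mp (by exact_mod_cast hd))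
    refine ⟨Int.val_eq_zero_or_val_eq_zero hmn 1 0 0 1 (by ring) (by ring) (by simpa using hq1),
      Int.val_eq_zero_or_val_eq_zero hmn 1 0 1 1 (by ring) (by ring) (by simpa using hq1),
      Int.val_eq_zero_or_val_eq_zero hmn 1 0 1 (-1) (by ring) (by ring) (by simpa using hq1),
      Int.val_eq_zero_or_val_eq_zero hmn 0 1 1 1 (by ring) (by ring) (by simpa using hq1),
      Int.val_eq_zero_or_val_eq_zero hmn 0 1 1 (-1) (by ring) (by ring) (by simpa using hq1), ?_⟩
    by_cases h2 : q = 2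
    · subst h2
      left
      exact Int.val_eq_zero (by push_cast; omega)
    · refine Int.val_eq_zero_or_val_eq_zero hmn 1 1 1 (-1) (by ring) (by ring) ?_
      norm_num
      intro hd
      exact h2 ((Nat.prime_dvd_prime_iff_eq hq Nat.prime_two).mp (by exact_mod_cast hd))
  have heven (q : ℕ) (hq : q.Prime) (h2 : q ≠ 2) (h3 : q ≠ 3) (hqp : q ≠ p) :
      Int.val q m % 2 = 0 ∧ Int.val q n % 2 = 0 ∧ Int.val q (m + n) % 2 = 0 ∧
        Int.val q (m - n) % 2 = 0 := by
    have h4 := hsum q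
    have h5 := hpair q hq
    simp only [h2.symm, h3.symm, hqp.symm, if_false] at h4
    omega
  have hsum2 := hsum 2
  have hsum3 := hsum 3
  have hsump := hsum p
  simp only [hp2, hp3, hp2.symm, hp3.symm, if_false, if_true, Nat.reduceEqDiff] at hsum2 hsum3 hsump
  have hpair2 := hpair 2 Nat.prime_two
  have hpair3 := hpair 3 Nat.prime_three
  have hpairp := hpair p hp
  have hem q hq h2 h3 hqp := (heven q hq h2 h3 hqp).1
  have hen q hq h2 h3 hqp := (heven q hq h2 h3 hqp).2.1
  have hes q hq h2 h3 hqp := (heven q hq h2 h3 hqp).2.2.1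
  have hed q hq h2 h3 hqp := (heven q hq h2 h3 hqp).2.2.2
  have hχ {x : ℤ} (hx : 0 < x)
      (hq : ∀ q : ℕ, q.Prime → q ≠ 2 → q ≠ 3 → q ≠ p → Int.val q x % 2 = 0)
      (hxp : Int.val p x = 0) : legendreSym p x = (-1) ^ (Int.val 3 x % 2) := by
    have := legendreSym.eq_sign_mul_of_seven_mod hmod hq
      (by rw [Int.dvd_iff_one_le_val hp hx.ne']; omega)
    rwa [Int.sign_eq_one_of_pos hx, one_mul] at this
  have hχ1 := legendreSym.neg_one_of_seven_mod hmod
  have hχ2 := legendreSym.two_of_seven_mod hmod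
  obtain ⟨k, hk⟩ : ∃ k : ℤ, (p : ℤ) = 24 * k + 7 := ⟨p / 24, by omega⟩
  have hpz (z : ℤ) : ((p : ℤ) * z) % 8 = (7 * z) % 8 := by
    rw [hk, show (24 * k + 7) * z = 7 * z + 8 * (3 * k * z) by ring, Int.add_mul_emod_self_left]
  have shape {x : ℤ} {i j k : ℕ} (hx : 0 < x) hq hi hj hk :=
    Int.exists_eq_mul_sq hp hp2 hp3 (x := x) (i := i) (j := j) (k := k) hx hq hi hj hk
  have h01 (a : ℕ) : a % 2 = 0 ∨ a % 2 = 1 := by omega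
  have hpodd : Int.val p m % 2 = 1 ∨ Int.val p n % 2 = 1 ∨ Int.val p (m + n) % 2 = 1 ∨
      Int.val p (m - n) % 2 = 1 := by omega
  have hs2 : Int.val 2 (m + n) = 0 := Int.val_eq_zero (by push_cast; omega)
  have hd2 : Int.val 2 (m - n) = 0 := Int.val_eq_zero (by push_cast; omega)
  rcases hpodd with ho | ho | ho | ho
  · exfalso
    have hdvd : (p : ℤ) ∣ m := (Int.dvd_iff_one_le_val hp hm.ne').mpr (by omega)
    have c1 := legendreSym.eq_mul_of_dvd_sub (x := m + n) (c := 1) (y := n) (by simpa using hdvd)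
    have c2 := legendreSym.eq_mul_of_dvd_sub (x := m - n) (c := -1) (y := n) (by simpa using hdvd)
    rw [hχ hs hes (by omega), hχ hn hen (by omega)] at c1
    rw [hχ hd hed (by omega), hχ hn hen (by omega)] at c2
    have : Int.val 3 n % 2 = 0 ∧ Int.val 3 (m + n) % 2 = 0 ∧ Int.val 3 (m - n) % 2 = 1 := by
      rcases h01 (Int.val 3 n) with h1 | h1 <;> rcases h01 (Int.val 3 (m + n)) with h2 | h2 <;>
      rcases h01 (Int.val 3 (m - n)) with h3 | h3 <;> simp [h1, h2, h3, hχ1] at c1 c2 <;> omega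
    obtain ⟨z₁, -, hz₁⟩ := shape (j := 0) (k := 1) hm hem rfl (by omega) (by omega)
    obtain ⟨z₂, -, hz₂⟩ := shape (j := 0) (k := 0) hn hen rfl (by omega) (by omega)
    obtain ⟨z₃, -, hz₃⟩ := shape (i := 0) (j := 0) (k := 0) hs hes (by omega) (by omega) (by omega)
    obtain ⟨z₄, -, hz₄⟩ := shape (i := 0) (j := 1) (k := 0) hd hed (by omega) (by omega) (by omega)
    have := Int.sq_emod_eight z₁
    have := Int.sq_emod_eight z₂
    have := Int.sq_emod_eight z₃
    have := Int.sq_emod_eight z₄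
    have := hpz (z₁ ^ 2)
    rcases h01 (Int.val 2 m) with h1 | h1 <;> rcases h01 (Int.val 2 n) with h2 | h2 <;>
    simp only [h1, h2, pow_zero, pow_one, one_mul] at hz₁ hz₂ hz₃ hz₄ <;> omega
  · have hdvd : (p : ℤ) ∣ n := (Int.dvd_iff_one_le_val hp hn.ne').mpr (by omega)
    have c1 := legendreSym.eq_mul_of_dvd_sub (x := m + n) (c := 1) (y := m) (by simpa using hdvd)
    have c2 := legendreSym.eq_mul_of_dvd_sub (x := m - n) (c := 1) (y := m) (by simpa using hdvd)
    rw [hχ hs hes (by omega), hχ hm hem (by omega)] at c1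
    rw [hχ hd hed (by omega), hχ hm hem (by omega)] at c2
    have : Int.val 3 m % 2 = 0 ∧ Int.val 3 (m + n) % 2 = 0 ∧ Int.val 3 (m - n) % 2 = 0 := by
      rcases h01 (Int.val 3 m) with h1 | h1 <;> rcases h01 (Int.val 3 (m + n)) with h2 | h2 <;>
      rcases h01 (Int.val 3 (m - n)) with h3 | h3 <;> simp [h1, h2, h3] at c1 c2 <;> omega
    obtain ⟨z₁, -, hz₁⟩ := shape (j := 0) (k := 0) hm hem rfl (by omega) (by omega)
    obtain ⟨z₂, hz₂0, hz₂⟩ := shape (j := 1) (k := 1) hn hen rfl (by omega) (by omega)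
    obtain ⟨z₃, -, hz₃⟩ := shape (i := 0) (j := 0) (k := 0) hs hes (by omega) (by omega) (by omega)
    obtain ⟨z₄, -, hz₄⟩ := shape (i := 0) (j := 0) (k := 0) hd hed (by omega) (by omega) (by omega)
    have := Int.sq_emod_eight z₁
    have := Int.sq_emod_eight z₂
    have := Int.sq_emod_eight z₃
    have := Int.sq_emod_eight z₄
    have := hpz (z₂ ^ 2)
    have h12 : Int.val 2 m % 2 = 0 ∧ Int.val 2 n % 2 = 1 := by
      rcases h01 (Int.val 2 m) with h1 | h1 <;> rcases h01 (Int.val 2 n) with h2 | h2 <;>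
      simp only [h1, h2, pow_zero, pow_one, one_mul] at hz₁ hz₂ hz₃ hz₄ <;> omega
    simp only [h12.1, h12.2, pow_zero, pow_one, one_mul] at hz₁ hz₂ hz₃ hz₄
    exact ⟨z₁, z₂, z₃, z₄, hz₂0, hz₁, by linarith, hz₃, hz₄⟩
  · exfalso
    have hdvd : (p : ℤ) ∣ m + n := (Int.dvd_iff_one_le_val hp hs.ne').mpr (by omega)
    have c1 := legendreSym.eq_mul_of_dvd_sub (x := m) (c := -1) (y := n)
      (by simpa using hdvd)
    have c2 := legendreSym.eq_mul_of_dvd_sub (x := m - n) (c := 2) (y := m)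
      (by rw [show m - n - 2 * m = -(m + n) by ring]; exact hdvd.neg_right)
    rw [hχ hm hem (by omega), hχ hn hen (by omega)] at c1
    rw [hχ hd hed (by omega), hχ hm hem (by omega)] at c2
    have : Int.val 3 n % 2 = 1 ∧ Int.val 3 m % 2 = 0 ∧ Int.val 3 (m - n) % 2 = 0 := by
      rcases h01 (Int.val 3 n) with h1 | h1 <;> rcases h01 (Int.val 3 m) with h2 | h2 <;>
      rcases h01 (Int.val 3 (m - n)) with h3 | h3 <;> simp [h1, h2, h3, hχ1, hχ2] at c1 c2 <;> omega
    obtain ⟨z₁, -, hz₁⟩ := shape (j := 0) (k := 0) hm hem rfl (by omega) (by omega)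
    obtain ⟨z₂, -, hz₂⟩ := shape (j := 1) (k := 0) hn hen rfl (by omega) (by omega)
    obtain ⟨z₃, -, hz₃⟩ := shape (i := 0) (j := 0) (k := 1) hs hes (by omega) (by omega) (by omega)
    obtain ⟨z₄, -, hz₄⟩ := shape (i := 0) (j := 0) (k := 0) hd hed (by omega) (by omega) (by omega)
    have := Int.sq_emod_eight z₁
    have := Int.sq_emod_eight z₂
    have := Int.sq_emod_eight z₃
    have := Int.sq_emod_eight z₄
    have := hpz (z₃ ^ 2)
    rcases h01 (Int.val 2 m) with h1 | h1 <;> rcases h01 (Int.val 2 n) with h2 | h2 <;>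
    simp only [h1, h2, pow_zero, pow_one, one_mul] at hz₁ hz₂ hz₃ hz₄ <;> omega
  · exfalso
    have hdvd : (p : ℤ) ∣ m - n := (Int.dvd_iff_one_le_val hp hd.ne').mpr (by omega)
    have c1 := legendreSym.eq_mul_of_dvd_sub (x := m) (c := 1) (y := n) (by simpa using hdvd)
    have c2 := legendreSym.eq_mul_of_dvd_sub (x := m + n) (c := 2) (y := n)
      (by rw [show m + n - 2 * n = m - n by ring]; exact hdvd)
    rw [hχ hm hem (by omega), hχ hn hen (by omega)] at c1
    rw [hχ hs hes (by omega), hχ hn hen (by omega)] at c2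
    have : Int.val 3 n % 2 = 0 ∧ Int.val 3 m % 2 = 0 ∧ Int.val 3 (m + n) % 2 = 0 := by
      rcases h01 (Int.val 3 n) with h1 | h1 <;> rcases h01 (Int.val 3 m) with h2 | h2 <;>
      rcases h01 (Int.val 3 (m + n)) with h3 | h3 <;> simp [h1, h2, h3, hχ2] at c1 c2 <;> omega
    obtain ⟨z₁, -, hz₁⟩ := shape (j := 0) (k := 0) hm hem rfl (by omega) (by omega)
    obtain ⟨z₂, -, hz₂⟩ := shape (j := 0) (k := 0) hn hen rfl (by omega) (by omega)
    obtain ⟨z₃, -, hz₃⟩ := shape (i := 0) (j := 0) (k := 0) hs hes (by omega) (by omega) (by omega)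
    obtain ⟨z₄, -, hz₄⟩ := shape (i := 0) (j := 1) (k := 1) hd hed (by omega) (by omega) (by omega)
    have := Int.sq_emod_eight z₁
    have := Int.sq_emod_eight z₂
    have := Int.sq_emod_eight z₃
    have := Int.sq_emod_eight z₄
    have := hpz (z₄ ^ 2)
    rcases h01 (Int.val 2 m) with h1 | h1 <;> rcases h01 (Int.val 2 n) with h2 | h2 <;>
    simp only [h1, h2, pow_zero, pow_one, one_mul] at hz₁ hz₂ hz₃ hz₄ <;> omega

theorem isCoprime_of_mul_eq_prime_mul_sq {p : ℕ} (hp : p.Prime) (hp2 : p ≠ 2) (hp3 : p ≠ 3)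
    {x y a f : ℤ} (haf : IsCoprime a f) (h1 : x ^ 2 + y ^ 2 = a ^ 2)
    (h2 : 2 * (x * y) = 6 * p * f ^ 2) : IsCoprime x y := by
  have hsq : Squarefree (6 * p) := by
    rw [Nat.squarefree_mul]
    · refine ⟨?_, hp.prime.squarefree⟩
      rw [show 6 = 2 * 3 by rfl, Nat.squarefree_mul (by norm_num)]
      exact ⟨Nat.prime_two.prime.squarefree, Nat.prime_three.prime.squarefree⟩
    · rw [show 6 = 2 * 3 by rfl]
      exact Nat.Coprime.mul_left ((Nat.coprime_primes Nat.prime_two hp).mpr hp2.symm)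
        ((Nat.coprime_primes Nat.prime_three hp).mpr hp3.symm)
  rw [Int.isCoprime_iff_gcd_eq_one]
  by_contra hne
  obtain ⟨q, hq, hqd⟩ := Nat.exists_prime_and_dvd hne
  have hqx : (q : ℤ) ∣ x := (Int.natCast_dvd_natCast.mpr hqd).trans (Int.gcd_dvd_left _ _)
  have hqy : (q : ℤ) ∣ y := (Int.natCast_dvd_natCast.mpr hqd).trans (Int.gcd_dvd_right _ _)
  have hqa : (q : ℤ) ∣ a := by
    apply (Nat.prime_iff_prime_int.mp hq).dvd_of_dvd_pow (n := 2)
    rw [← h1]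
    exact dvd_add (dvd_pow hqx two_ne_zero) (dvd_pow hqy two_ne_zero)
  have hqf : IsCoprime ((q : ℤ) * q) (f ^ 2) :=
    have := haf.of_isCoprime_of_dvd_left hqa
    (this.mul_left this).pow_right
  have : (q : ℤ) * q ∣ 6 * p := by
    apply hqf.dvd_of_dvd_mul_right
    rw [← h2]
    exact (mul_dvd_mul hqx hqy).mul_left 2
  exact hq.one_lt.ne' (Nat.isUnit_iff.mp (hsq q (by exact_mod_cast this)))

set_option maxHeartbeats 1000000 in
theorem eq_zero_of_sq_add_sq_sub_six_mul_prime_aux {p : ℕ} (hp : p.Prime)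
    (hmod : p % 24 = 7) (N : ℕ) : ∀ a f e b : ℤ, a.natAbs ≤ N → IsCoprime a f →
      a ^ 2 + 6 * p * f ^ 2 = e ^ 2 → a ^ 2 - 6 * p * f ^ 2 = b ^ 2 → f = 0 := by
  induction N with
  | zero =>
    intro a f e b ha _ _ h2
    have ha0 : a = 0 := by omega
    subst ha0
    have hpos : (0 : ℤ) < p := by exact_mod_cast hp.pos
    by_contra hf
    have : 0 < 6 * (p : ℤ) * f ^ 2 := by positivity
    nlinarith [sq_nonneg b]
  | succ N ih =>
    intro a f e b ha haf h1 h2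
    by_contra hf
    obtain ⟨k, hk⟩ : ∃ k : ℤ, (p : ℤ) = 24 * k + 7 := ⟨p / 24, by omega⟩
    have hpz : ((p : ℤ) * f ^ 2) % 8 = (7 * f ^ 2) % 8 := by
      rw [hk, show (24 * k + 7) * f ^ 2 = 7 * f ^ 2 + 8 * (3 * k * f ^ 2) by ring,
        Int.add_mul_emod_self_left]
    have hodd : ¬ (a % 2 = 0 ∧ f % 2 = 0) := by
      rintro ⟨h3, h4⟩
      have := haf.isUnit_of_dvd' (Int.dvd_of_emod_eq_zero h3) (Int.dvd_of_emod_eq_zero h4)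
      exact absurd this (by decide)
    have ha8 := Int.sq_emod_eight a
    have hf8 := Int.sq_emod_eight f
    have he8 := Int.sq_emod_eight e
    have hb8 := Int.sq_emod_eight b
    rw [mul_assoc] at h1 h2
    obtain ⟨g, hg⟩ : ∃ g, f = 2 * g := ⟨f / 2, by omega⟩
    obtain ⟨y, hy⟩ : ∃ y, e = b + 2 * y := ⟨(e - b) / 2, by omega⟩
    have hx2 : (b + y) ^ 2 + y ^ 2 = a ^ 2 := by rw [hy] at h1; linarith
    have hxy : 2 * ((b + y) * y) = 6 * p * f ^ 2 := by rw [hy] at h1; linarith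
    have hc := isCoprime_of_mul_eq_prime_mul_sq hp (by omega) (by omega) haf hx2 hxy
    have hpt : PythagoreanTriple (b + y) y a := by unfold PythagoreanTriple; linarith
    obtain ⟨m, n, h3, h4, h5, h6⟩ := PythagoreanTriple.coprime_classification.mp
      ⟨hpt, Int.isCoprime_iff_gcd_eq_one.mp hc⟩
    have hmn : IsCoprime m n := Int.isCoprime_iff_gcd_eq_one.mpr h5
    have hprod : m * n * (m ^ 2 - n ^ 2) = 6 * p * g ^ 2 := by
      have : (b + y) * y = 2 * (m * n * (m ^ 2 - n ^ 2)) := by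
        rcases h3 with ⟨h3, h3'⟩ | ⟨h3, h3'⟩ <;> rw [h3, h3'] <;> ring
      rw [this, hg] at hxy
      linarith
    have hg0 : g ≠ 0 := by rintro rfl; exact hf (by rw [hg]; rfl)
    have hpos : 0 < m * n * (m ^ 2 - n ^ 2) := by
      have : (0 : ℤ) < p := by exact_mod_cast hp.pos
      rw [hprod]; positivity
    have finish (M K : ℤ) (hK : 0 < K) (hKM : K < M) (hMK : IsCoprime M K)
        (hMKodd : (M + K) % 2 = 1) (hM : M * K * (M ^ 2 - K ^ 2) = 6 * p * g ^ 2)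
        (haMK : a = M ^ 2 + K ^ 2 ∨ a = -(M ^ 2 + K ^ 2)) : False := by
      obtain ⟨a', f', e', b', hf', h7, h8, h9, h10⟩ :=
        exists_of_mul_mul_mul_eq_six_mul_prime hp hmod hK hKM hMK hMKodd (g := g)
          (by rw [← hM]; ring)
      have hc' : IsCoprime a' f' := by
        rw [h7, h8] at hMK
        exact (IsCoprime.pow_iff two_pos two_pos).mp hMK.of_mul_right_right
      have hlt : |a'| < |a| := by
        have h11 : |a| = M ^ 2 + K ^ 2 := by
          rcases haMK with h | h <;> rw [h]
          · exact abs_of_nonneg (by positivity)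
          · rw [abs_neg, abs_of_nonneg (by positivity)]
        have h12 : |a'| ≤ M := by
          rw [h7, ← Int.natCast_natAbs]
          exact Int.natAbs_le_self_sq a'
        have h13 : M ≤ M ^ 2 := by nlinarith
        have h14 : 0 < K ^ 2 := by positivity
        linarith
      rw [Int.abs_eq_natAbs, Int.abs_eq_natAbs] at hlt
      exact hf' (ih a' f' e' b' (by omega) hc' (by rw [← h9, h7, h8]) (by rw [← h10, h7, h8]))
    have habs : IsCoprime |m| |n| := hmn.abs_abs
    have hparity : (|m| + |n|) % 2 = 1 := by
      rcases abs_choice m with h | h <;> rcases abs_choice n with h' | h' <;> rw [h, h'] <;> omega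
    have hm0 : m ≠ 0 := by rintro rfl; simp at hpos
    have hn0 : n ≠ 0 := by rintro rfl; simp at hpos
    rcases lt_trichotomy |m| |n| with hlt | heq | hlt
    · have hmn2 : m ^ 2 < n ^ 2 := sq_lt_sq.mpr hlt
      have hneg : m * n < 0 := by
        by_contra! h0
        exact absurd hpos (not_lt.mpr (mul_nonpos_of_nonneg_of_nonpos h0 (by linarith)))
      refine finish |n| |m| (abs_pos.mpr hm0) hlt habs.symm (by rw [add_comm]; exact hparity) ?_ ?_
      · rw [← abs_mul, sq_abs, sq_abs, mul_comm n m, abs_of_neg hneg, ← hprod]; ring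
      · rw [sq_abs, sq_abs]
        rcases h4 with h4 | h4 <;> [left; right] <;> rw [h4] <;> ring
    · rw [← sq_eq_sq_iff_abs_eq_abs] at heq
      simp [heq] at hpos
    · have hmn2 : n ^ 2 < m ^ 2 := sq_lt_sq.mpr hlt
      have hpos' : 0 < m * n := pos_of_mul_pos_left hpos (by linarith)
      refine finish |m| |n| (abs_pos.mpr hn0) hlt habs hparity ?_ ?_
      · rw [← abs_mul, sq_abs, sq_abs, abs_of_pos hpos', hprod]
      · rwa [sq_abs, sq_abs]

/-- `6 * p` is not a congruent number for a prime `p` that is `7` modulo `24`. -/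
theorem eq_zero_of_sq_add_sq_sub_six_mul_prime {p : ℕ} (hp : p.Prime)
    (hmod : p % 24 = 7) {a f e b : ℤ} (h1 : a ^ 2 + 6 * p * f ^ 2 = e ^ 2)
    (h2 : a ^ 2 - 6 * p * f ^ 2 = b ^ 2) : f = 0 := by
  by_contra hf
  obtain ⟨g, f', a', hg, hc, rfl, rfl⟩ := Int.exists_eq_mul_isCoprime (y := a) hf
  have hge : g ∣ e := by
    rw [← Int.pow_dvd_pow_iff two_ne_zero, ← h1]
    exact ⟨a' ^ 2 + 6 * p * f' ^ 2, by ring⟩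
  have hgb : g ∣ b := by
    rw [← Int.pow_dvd_pow_iff two_ne_zero, ← h2]
    exact ⟨a' ^ 2 - 6 * p * f' ^ 2, by ring⟩
  obtain ⟨e', rfl⟩ := hge
  obtain ⟨b', rfl⟩ := hgb
  have hg0 : g ^ 2 ≠ 0 := by
    positivity
  refine right_ne_zero_of_mul hf (eq_zero_of_sq_add_sq_sub_six_mul_prime_aux hp hmod _ a' f' e' b'
    le_rfl hc.symm ?_ ?_)
  · apply mul_left_cancel₀ hg0; linarith
  · apply mul_left_cancel₀ hg0; linarith

theorem Int.exists_eq_sign_mul_sq {p : ℕ} (hp : p.Prime) (hp2 : p ≠ 2) (hp3 : p ≠ 3) {x s : ℤ}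
    (hx : x ≠ 0) (h : ∀ q : ℕ, q.Prime → q ≠ 2 → q ≠ 3 → q ≠ p → Int.val q x % 2 = 0)
    {j k : ℕ} (hs : x.sign = s) (hj : Int.val 3 x % 2 = j) (hk : Int.val p x % 2 = k) :
    ∃ z : ℤ, z ≠ 0 ∧ x = s * (2 ^ (Int.val 2 x % 2) * (3 ^ j * ((p : ℤ) ^ k * z ^ 2))) := by
  obtain ⟨z, hz, hxz⟩ := Int.exists_abs_eq_mul_sq hp hp2 hp3 hx h
  refine ⟨z, hz, ?_⟩
  rw [hj, hk] at hxz
  calc x = x.sign * |x| := (Int.sign_mul_abs x).symm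
    _ = _ := by rw [hxz, hs]; ring

theorem legendreSym.eq_mul_of_eq_add_mul {p : ℕ} [Fact p.Prime] {l c x y : ℤ} (hl : (p : ℤ) ∣ l)
    (k : ℤ) (h : x = c * y + k * l) : legendreSym p x = legendreSym p c * legendreSym p y :=
  legendreSym.eq_mul_of_dvd_sub (by rw [h, add_sub_cancel_left]; exact hl.mul_left k)

/-- The parities of the valuations at `q` of the six linear forms
`n`, `m`, `m + n`, `m - n`, `m + 2 * n`, `m - 2 * n`. -/
def ValParities (q : ℕ) (m n : ℤ) (a b c d e f : ℕ) : Prop :=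
  Int.val q n % 2 = a ∧ Int.val q m % 2 = b ∧ Int.val q (m + n) % 2 = c ∧
    Int.val q (m - n) % 2 = d ∧ Int.val q (m + 2 * n) % 2 = e ∧ Int.val q (m - 2 * n) % 2 = f

/-- The signs of the six linear forms
`n`, `m`, `m + n`, `m - n`, `m + 2 * n`, `m - 2 * n`. -/
def Signs (m n a b c d e f : ℤ) : Prop :=
  n.sign = a ∧ m.sign = b ∧ (m + n).sign = c ∧ (m - n).sign = d ∧ (m + 2 * n).sign = e ∧
    (m - 2 * n).sign = f

/-- The local information on a coprime pair `(m, n)` for which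
`n * m * (m + n) * (m - n) * (m + 2 * n) * (m - 2 * n)` is `p` times a nonzero square. -/
structure LocalConditions (p : ℕ) (m n : ℤ) : Prop where
  pos : 0 < n
  coprime : IsCoprime m n
  even (q : ℕ) : q.Prime → q ≠ 2 → q ≠ 3 → q ≠ p → ValParities q m n 0 0 0 0 0 0
  signs : Signs m n 1 1 1 1 1 1 ∨ Signs m n 1 1 1 (-1) 1 (-1) ∨ Signs m n 1 (-1) (-1) (-1) 1 (-1)
  three : ValParities 3 m n 0 0 0 0 0 0 ∨ ValParities 3 m n 0 0 0 1 1 0 ∨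
    ValParities 3 m n 0 0 1 0 0 1
  two : (n % 2 = 0 ∧ m % 2 = 1 ∧ ValParities 2 m n 0 0 0 0 0 0) ∨
    (n % 2 = 1 ∧ m % 2 = 1 ∧ ValParities 2 m n 0 0 1 1 0 0) ∨
    (n % 2 = 1 ∧ m % 4 = 0 ∧ ValParities 2 m n 0 0 0 0 1 1) ∨
    (n % 2 = 1 ∧ m % 4 = 2 ∧ ValParities 2 m n 0 1 0 0 1 0) ∨
    (n % 2 = 1 ∧ m % 4 = 2 ∧ ValParities 2 m n 0 1 0 0 0 1)

namespace LocalConditions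

variable {p : ℕ} {m n : ℤ}

theorem legendreSym_eq [Fact p.Prime] (h : LocalConditions p m n) (hmod : p % 24 = 7) :
    (¬ (p : ℤ) ∣ n → legendreSym p n = n.sign * (-1) ^ (Int.val 3 n % 2)) ∧
    (¬ (p : ℤ) ∣ m → legendreSym p m = m.sign * (-1) ^ (Int.val 3 m % 2)) ∧
    (¬ (p : ℤ) ∣ m + n → legendreSym p (m + n) = (m + n).sign * (-1) ^ (Int.val 3 (m + n) % 2)) ∧
    (¬ (p : ℤ) ∣ m - n → legendreSym p (m - n) = (m - n).sign * (-1) ^ (Int.val 3 (m - n) % 2)) ∧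
    (¬ (p : ℤ) ∣ m + 2 * n → legendreSym p (m + 2 * n) =
      (m + 2 * n).sign * (-1) ^ (Int.val 3 (m + 2 * n) % 2)) ∧
    (¬ (p : ℤ) ∣ m - 2 * n → legendreSym p (m - 2 * n) =
      (m - 2 * n).sign * (-1) ^ (Int.val 3 (m - 2 * n) % 2)) :=
  ⟨legendreSym.eq_sign_mul_of_seven_mod hmod fun q h1 h2 h3 h4 ↦ (h.even q h1 h2 h3 h4).1,
    legendreSym.eq_sign_mul_of_seven_mod hmod fun q h1 h2 h3 h4 ↦ (h.even q h1 h2 h3 h4).2.1,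
    legendreSym.eq_sign_mul_of_seven_mod hmod fun q h1 h2 h3 h4 ↦ (h.even q h1 h2 h3 h4).2.2.1,
    legendreSym.eq_sign_mul_of_seven_mod hmod fun q h1 h2 h3 h4 ↦ (h.even q h1 h2 h3 h4).2.2.2.1,
    legendreSym.eq_sign_mul_of_seven_mod hmod fun q h1 h2 h3 h4 ↦ (h.even q h1 h2 h3 h4).2.2.2.2.1,
    legendreSym.eq_sign_mul_of_seven_mod hmod fun q h1 h2 h3 h4 ↦
      (h.even q h1 h2 h3 h4).2.2.2.2.2⟩

/-- The factorizations of the six linear forms, once signs and valuations at `3` and `p` are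
known. -/
theorem exists_eq (h : LocalConditions p m n) (hp : p.Prime) (hp2 : p ≠ 2) (hp3 : p ≠ 3)
    {s₁ s₂ s₃ s₄ s₅ s₆ : ℤ} (hs : Signs m n s₁ s₂ s₃ s₄ s₅ s₆)
    (hs0 : s₂ * s₃ * s₄ * s₅ * s₆ ≠ 0) {j₁ j₂ j₃ j₄ j₅ j₆ : ℕ}
    (hj : ValParities 3 m n j₁ j₂ j₃ j₄ j₅ j₆) {k₁ k₂ k₃ k₄ k₅ k₆ : ℕ}
    (hk : ValParities p m n k₁ k₂ k₃ k₄ k₅ k₆) {i₁ i₂ i₃ i₄ i₅ i₆ : ℕ}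
    (hi : ValParities 2 m n i₁ i₂ i₃ i₄ i₅ i₆) :
    ∃ z₁ z₂ z₃ z₄ z₅ z₆ : ℤ, z₁ ≠ 0 ∧ z₂ ≠ 0 ∧ z₃ ≠ 0 ∧ z₄ ≠ 0 ∧ z₅ ≠ 0 ∧ z₆ ≠ 0 ∧
      n = s₁ * (2 ^ i₁ * (3 ^ j₁ * ((p : ℤ) ^ k₁ * z₁ ^ 2))) ∧
      m = s₂ * (2 ^ i₂ * (3 ^ j₂ * ((p : ℤ) ^ k₂ * z₂ ^ 2))) ∧
      m + n = s₃ * (2 ^ i₃ * (3 ^ j₃ * ((p : ℤ) ^ k₃ * z₃ ^ 2))) ∧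
      m - n = s₄ * (2 ^ i₄ * (3 ^ j₄ * ((p : ℤ) ^ k₄ * z₄ ^ 2))) ∧
      m + 2 * n = s₅ * (2 ^ i₅ * (3 ^ j₅ * ((p : ℤ) ^ k₅ * z₅ ^ 2))) ∧
      m - 2 * n = s₆ * (2 ^ i₆ * (3 ^ j₆ * ((p : ℤ) ^ k₆ * z₆ ^ 2))) := by
  obtain ⟨hs1, hs2, hs3, hs4, hs5, hs6⟩ := hs
  obtain ⟨hj1, hj2, hj3, hj4, hj5, hj6⟩ := hj
  obtain ⟨hk1, hk2, hk3, hk4, hk5, hk6⟩ := hk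
  obtain ⟨rfl, rfl, rfl, rfl, rfl, rfl⟩ := hi
  simp only [ne_eq, mul_eq_zero, not_or, ← hs2, ← hs3, ← hs4, ← hs5, ← hs6,
    Int.sign_eq_zero_iff_zero] at hs0
  obtain ⟨⟨⟨⟨h2, h3⟩, h4⟩, h5⟩, h6⟩ := hs0
  obtain ⟨z₁, hz₁, e₁⟩ := Int.exists_eq_sign_mul_sq hp hp2 hp3 h.pos.ne'
    (fun q h1 h2 h3 h4 ↦ (h.even q h1 h2 h3 h4).1) hs1 hj1 hk1
  obtain ⟨z₂, hz₂, e₂⟩ := Int.exists_eq_sign_mul_sq hp hp2 hp3 h2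
    (fun q h1 h2 h3 h4 ↦ (h.even q h1 h2 h3 h4).2.1) hs2 hj2 hk2
  obtain ⟨z₃, hz₃, e₃⟩ := Int.exists_eq_sign_mul_sq hp hp2 hp3 h3
    (fun q h1 h2 h3 h4 ↦ (h.even q h1 h2 h3 h4).2.2.1) hs3 hj3 hk3
  obtain ⟨z₄, hz₄, e₄⟩ := Int.exists_eq_sign_mul_sq hp hp2 hp3 h4
    (fun q h1 h2 h3 h4 ↦ (h.even q h1 h2 h3 h4).2.2.2.1) hs4 hj4 hk4
  obtain ⟨z₅, hz₅, e₅⟩ := Int.exists_eq_sign_mul_sq hp hp2 hp3 h5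
    (fun q h1 h2 h3 h4 ↦ (h.even q h1 h2 h3 h4).2.2.2.2.1) hs5 hj5 hk5
  obtain ⟨z₆, hz₆, e₆⟩ := Int.exists_eq_sign_mul_sq hp hp2 hp3 h6
    (fun q h1 h2 h3 h4 ↦ (h.even q h1 h2 h3 h4).2.2.2.2.2) hs6 hj6 hk6
  exact ⟨z₁, z₂, z₃, z₄, z₅, z₆, hz₁, hz₂, hz₃, hz₄, hz₅, hz₆, e₁, e₂, e₃, e₄, e₅, e₆⟩

end LocalConditions

theorem Int.natCast_mul_emod_eight_of_seven_mod {p : ℕ} (hmod : p % 24 = 7) (z : ℤ) :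
    ((p : ℤ) * z) % 8 = (7 * z) % 8 := by
  obtain ⟨k, hk⟩ : ∃ k : ℤ, (p : ℤ) = 24 * k + 7 := ⟨p / 24, by omega⟩
  rw [hk, show (24 * k + 7) * z = 7 * z + 8 * (3 * k * z) by ring, Int.add_mul_emod_self_left]

namespace LocalConditions

variable {p : ℕ} {m n : ℤ}

theorem signs_and_three_of_dvd_right [Fact p.Prime] (h : LocalConditions p m n)
    (hmod : p % 24 = 7) (hd : (p : ℤ) ∣ n) (h2 : ¬ (p : ℤ) ∣ m) (h3 : ¬ (p : ℤ) ∣ m + n)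
    (h4 : ¬ (p : ℤ) ∣ m - n) (h5 : ¬ (p : ℤ) ∣ m + 2 * n) :
    Signs m n 1 1 1 1 1 1 ∧ ValParities 3 m n 0 0 0 0 0 0 := by
  obtain ⟨-, g2, g3, g4, g5, -⟩ := h.legendreSym_eq hmod
  have c1 := legendreSym.eq_mul_of_eq_add_mul (x := m + n) (c := 1) (y := m)
    hd 1 (by ring)
  rw [g3 h3, g2 h2] at c1
  have c2 := legendreSym.eq_mul_of_eq_add_mul (x := m - n) (c := 1) (y := m)
    hd (-1) (by ring)
  rw [g4 h4, g2 h2] at c2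
  have c3 := legendreSym.eq_mul_of_eq_add_mul (x := m + 2 * n) (c := 1) (y := m)
    hd 2 (by ring)
  rw [g5 h5, g2 h2] at c3
  rcases h.signs with hs | hs | hs <;> rcases h.three with ht | ht | ht <;>
    first
    | exact ⟨hs, ht⟩
    | exfalso
      obtain ⟨-, s2, s3, s4, s5, -⟩ := hs
      obtain ⟨-, t2, t3, t4, t5, -⟩ := ht
      simp [s2, s3, s4, s5, t2, t3, t4, t5] at c1 c2 c3

theorem not_dvd_right (h : LocalConditions p m n) (hp : p.Prime) (hmod : p % 24 = 7)
    (hk : ValParities p m n 1 0 0 0 0 0) (h2 : ¬ (p : ℤ) ∣ m) (h3 : ¬ (p : ℤ) ∣ m + n)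
    (h4 : ¬ (p : ℤ) ∣ m - n) (h5 : ¬ (p : ℤ) ∣ m + 2 * n) :
    ¬ (p : ℤ) ∣ n := by
  intro hd
  have := Fact.mk hp
  obtain ⟨hs, ht⟩ := h.signs_and_three_of_dvd_right hmod hd h2 h3 h4 h5
  rcases h.two with ⟨hn, hm, hi⟩ | ⟨hn, hm, hi⟩ | ⟨hn, hm, hi⟩ | ⟨hn, hm, hi⟩ | ⟨hn, hm, hi⟩ <;>
  obtain ⟨z₁, z₂, z₃, z₄, z₅, z₆, hz₁, hz₂, hz₃, hz₄, hz₅, hz₆, e₁, e₂, e₃, e₄, e₅, e₆⟩ :=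
    h.exists_eq hp (by omega) (by omega) hs (by decide) ht hk hi <;>
  simp only [pow_zero, pow_one, one_mul] at e₁ e₂ e₃ e₄ e₅ e₆
  · have hc : IsCoprime (m - n) m := by
      rw [← neg_sub, IsCoprime.neg_left_iff]
      simpa [sub_eq_add_neg] using (IsCoprime.add_mul_left_left h.coprime.symm (-1))
    rw [e₄, e₂, IsCoprime.pow_iff two_pos two_pos] at hc
    have := sq_eq_sq_of_four_sq_arith_prog hz₄ hz₂ hc (a := z₆) (d := z₃) (by linarith)
      (by linarith)
    linarith [h.pos]
  · have := Int.sq_emod_eight z₁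
    have := Int.sq_emod_eight z₂
    have := Int.sq_emod_eight z₅
    have := Int.natCast_mul_emod_eight_of_seven_mod hmod (z₁ ^ 2)
    omega
  · have := Int.sq_emod_eight z₁
    have := Int.sq_emod_eight z₄
    have := Int.sq_emod_eight z₅
    have := Int.natCast_mul_emod_eight_of_seven_mod hmod (z₁ ^ 2)
    omega
  · have := Int.sq_emod_eight z₁
    have := Int.sq_emod_eight z₂
    have := Int.sq_emod_eight z₄
    have := Int.natCast_mul_emod_eight_of_seven_mod hmod (z₁ ^ 2)
    omega
  · have := Int.sq_emod_eight z₁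
    have := Int.sq_emod_eight z₂
    have := Int.sq_emod_eight z₄
    have := Int.natCast_mul_emod_eight_of_seven_mod hmod (z₁ ^ 2)
    omega

theorem signs_and_three_of_dvd_left [Fact p.Prime] (h : LocalConditions p m n)
    (hmod : p % 24 = 7) (hd : (p : ℤ) ∣ m) (h1 : ¬ (p : ℤ) ∣ n) (h3 : ¬ (p : ℤ) ∣ m + n)
    (h4 : ¬ (p : ℤ) ∣ m - n) (h5 : ¬ (p : ℤ) ∣ m + 2 * n) (h6 : ¬ (p : ℤ) ∣ m - 2 * n) :
    Signs m n 1 1 1 (-1) 1 (-1) ∧ ValParities 3 m n 0 0 0 0 0 0 := by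
  have e1 := legendreSym.neg_one_of_seven_mod hmod
  have e2 := legendreSym.two_of_seven_mod hmod
  obtain ⟨g1, -, g3, g4, g5, g6⟩ := h.legendreSym_eq hmod
  have c1 := legendreSym.eq_mul_of_eq_add_mul (x := m + n) (c := 1) (y := n)
    hd 1 (by ring)
  rw [g3 h3, g1 h1] at c1
  have c2 := legendreSym.eq_mul_of_eq_add_mul (x := m - n) (c := -1) (y := n)
    hd 1 (by ring)
  rw [g4 h4, g1 h1] at c2
  have c3 := legendreSym.eq_mul_of_eq_add_mul (x := m + 2 * n) (c := 2) (y := n)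
    hd 1 (by ring)
  rw [g5 h5, g1 h1] at c3
  have c4 := legendreSym.eq_mul_of_eq_add_mul (x := m - 2 * n) (c := 2) (y := m - n)
    hd (-1) (by ring)
  rw [g6 h6, g4 h4] at c4
  rcases h.signs with hs | hs | hs <;> rcases h.three with ht | ht | ht <;>
    first
    | exact ⟨hs, ht⟩
    | exfalso
      obtain ⟨s1, -, s3, s4, s5, s6⟩ := hs
      obtain ⟨t1, -, t3, t4, t5, t6⟩ := ht
      simp [s1, s3, s4, s5, s6, t1, t3, t4, t5, t6, e1, e2] at c1 c2 c3 c4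

theorem not_dvd_left (h : LocalConditions p m n) (hp : p.Prime) (hmod : p % 24 = 7)
    (hk : ValParities p m n 0 1 0 0 0 0) (h1 : ¬ (p : ℤ) ∣ n) (h3 : ¬ (p : ℤ) ∣ m + n)
    (h4 : ¬ (p : ℤ) ∣ m - n) (h5 : ¬ (p : ℤ) ∣ m + 2 * n) (h6 : ¬ (p : ℤ) ∣ m - 2 * n) :
    ¬ (p : ℤ) ∣ m := by
  intro hd
  have := Fact.mk hp
  obtain ⟨hs, ht⟩ := h.signs_and_three_of_dvd_left hmod hd h1 h3 h4 h5 h6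
  rcases h.two with ⟨hn, hm, hi⟩ | ⟨hn, hm, hi⟩ | ⟨hn, hm, hi⟩ | ⟨hn, hm, hi⟩ | ⟨hn, hm, hi⟩ <;>
  obtain ⟨z₁, z₂, z₃, z₄, z₅, z₆, hz₁, hz₂, hz₃, hz₄, hz₅, hz₆, e₁, e₂, e₃, e₄, e₅, e₆⟩ :=
    h.exists_eq hp (by omega) (by omega) hs (by decide) ht hk hi <;>
  simp only [pow_zero, pow_one, one_mul, neg_mul] at e₁ e₂ e₃ e₄ e₅ e₆
  · have := Int.sq_emod_eight z₁
    have := Int.sq_emod_eight z₂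
    have := Int.sq_emod_eight z₃
    have := Int.natCast_mul_emod_eight_of_seven_mod hmod (z₂ ^ 2)
    omega
  · have := Int.sq_emod_eight z₁
    have := Int.sq_emod_eight z₂
    have := Int.sq_emod_eight z₆
    have := Int.natCast_mul_emod_eight_of_seven_mod hmod (z₂ ^ 2)
    omega
  · have hc : IsCoprime n (m + 2 * n) := by
      simpa [mul_comm] using IsCoprime.add_mul_left_right h.coprime.symm 2
    rw [e₅, e₁] at hc
    have := sq_eq_sq_of_four_sq_arith_prog hz₁ hz₅
      ((IsCoprime.pow_iff two_pos two_pos).mp hc.of_mul_right_right) (a := z₆) (d := z₃)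
      (by linarith) (by linarith)
    have : m = 0 := by linarith
    rw [this] at hs
    exact absurd hs.2.1 (by decide)
  · have := Int.sq_emod_eight z₁
    have := Int.sq_emod_eight z₂
    have := Int.sq_emod_eight z₃
    have := Int.natCast_mul_emod_eight_of_seven_mod hmod (z₂ ^ 2)
    omega
  · have := Int.sq_emod_eight z₁
    have := Int.sq_emod_eight z₂
    have := Int.sq_emod_eight z₃
    have := Int.natCast_mul_emod_eight_of_seven_mod hmod (z₂ ^ 2)
    omega

theorem signs_and_three_of_dvd_add [Fact p.Prime] (h : LocalConditions p m n)
    (hmod : p % 24 = 7) (hd : (p : ℤ) ∣ m + n) (h1 : ¬ (p : ℤ) ∣ n) (h2 : ¬ (p : ℤ) ∣ m)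
    (h4 : ¬ (p : ℤ) ∣ m - n) (h6 : ¬ (p : ℤ) ∣ m - 2 * n) :
    Signs m n 1 (-1) (-1) (-1) 1 (-1) ∧ ValParities 3 m n 0 0 1 0 0 1 := by
  have e1 := legendreSym.neg_one_of_seven_mod hmod
  have e2 := legendreSym.two_of_seven_mod hmod
  have e3 := legendreSym.three_of_seven_mod hmod
  obtain ⟨g1, g2, -, g4, -, g6⟩ := h.legendreSym_eq hmod
  have c1 := legendreSym.eq_mul_of_eq_add_mul (x := m) (c := -1) (y := n)
    hd 1 (by ring)
  rw [g2 h2, g1 h1] at c1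
  have c2 := legendreSym.eq_mul_of_eq_add_mul (x := m - n) (c := 2) (y := m)
    hd (-1) (by ring)
  rw [g4 h4, g2 h2] at c2
  have c3 := legendreSym.eq_mul_of_eq_add_mul (x := m - 2 * n) (c := 3) (y := m)
    hd (-2) (by ring)
  rw [g6 h6, g2 h2] at c3
  rcases h.signs with hs | hs | hs <;> rcases h.three with ht | ht | ht <;>
    first
    | exact ⟨hs, ht⟩
    | exfalso
      obtain ⟨s1, s2, -, s4, -, s6⟩ := hs
      obtain ⟨t1, t2, -, t4, -, t6⟩ := ht
      simp [s1, s2, s4, s6, t1, t2, t4, t6, e1, e2, e3] at c1 c2 c3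

theorem not_dvd_add (h : LocalConditions p m n) (hp : p.Prime) (hmod : p % 24 = 7)
    (hk : ValParities p m n 0 0 1 0 0 0) (h1 : ¬ (p : ℤ) ∣ n) (h2 : ¬ (p : ℤ) ∣ m)
    (h4 : ¬ (p : ℤ) ∣ m - n) (h6 : ¬ (p : ℤ) ∣ m - 2 * n) :
    ¬ (p : ℤ) ∣ m + n := by
  intro hd
  have := Fact.mk hp
  obtain ⟨hs, ht⟩ := h.signs_and_three_of_dvd_add hmod hd h1 h2 h4 h6
  rcases h.two with ⟨hn, hm, hi⟩ | ⟨hn, hm, hi⟩ | ⟨hn, hm, hi⟩ | ⟨hn, hm, hi⟩ | ⟨hn, hm, hi⟩ <;>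
  obtain ⟨z₁, z₂, z₃, z₄, z₅, z₆, hz₁, hz₂, hz₃, hz₄, hz₅, hz₆, e₁, e₂, e₃, e₄, e₅, e₆⟩ :=
    h.exists_eq hp (by omega) (by omega) hs (by decide) ht hk hi <;>
  simp only [pow_zero, pow_one, one_mul, neg_mul] at e₁ e₂ e₃ e₄ e₅ e₆
  · have := Int.sq_emod_eight z₁
    have := Int.sq_emod_eight z₂
    have := Int.sq_emod_eight z₅
    omega
  · exact hz₃ (eq_zero_of_sq_add_sq_sub_six_mul_prime hp hmod (a := z₁) (e := z₂) (b := z₅)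
      (by linarith) (by linarith))
  · have := Int.sq_emod_eight z₁
    have := Int.sq_emod_eight z₃
    have := Int.natCast_mul_emod_eight_of_seven_mod hmod (z₃ ^ 2)
    omega
  · have := Int.sq_emod_eight z₁
    have := Int.sq_emod_eight z₄
    omega
  · have := Int.sq_emod_eight z₁
    have := Int.sq_emod_eight z₄
    omega

theorem signs_and_three_of_dvd_sub [Fact p.Prime] (h : LocalConditions p m n)
    (hmod : p % 24 = 7) (hd : (p : ℤ) ∣ m - n) (h1 : ¬ (p : ℤ) ∣ n) (h2 : ¬ (p : ℤ) ∣ m)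
    (h3 : ¬ (p : ℤ) ∣ m + n) (h5 : ¬ (p : ℤ) ∣ m + 2 * n) (h6 : ¬ (p : ℤ) ∣ m - 2 * n) :
    Signs m n 1 1 1 (-1) 1 (-1) ∧ ValParities 3 m n 0 0 0 1 1 0 := by
  have e1 := legendreSym.neg_one_of_seven_mod hmod
  have e2 := legendreSym.two_of_seven_mod hmod
  have e3 := legendreSym.three_of_seven_mod hmod
  obtain ⟨g1, g2, g3, -, g5, g6⟩ := h.legendreSym_eq hmod
  have c1 := legendreSym.eq_mul_of_eq_add_mul (x := m) (c := 1) (y := n)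
    hd 1 (by ring)
  rw [g2 h2, g1 h1] at c1
  have c2 := legendreSym.eq_mul_of_eq_add_mul (x := m + n) (c := 2) (y := n)
    hd 1 (by ring)
  rw [g3 h3, g1 h1] at c2
  have c3 := legendreSym.eq_mul_of_eq_add_mul (x := m + 2 * n) (c := 3) (y := n)
    hd 1 (by ring)
  rw [g5 h5, g1 h1] at c3
  have c4 := legendreSym.eq_mul_of_eq_add_mul (x := m - 2 * n) (c := -1) (y := n)
    hd 1 (by ring)
  rw [g6 h6, g1 h1] at c4
  rcases h.signs with hs | hs | hs <;> rcases h.three with ht | ht | ht <;>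
    first
    | exact ⟨hs, ht⟩
    | exfalso
      obtain ⟨s1, s2, s3, -, s5, s6⟩ := hs
      obtain ⟨t1, t2, t3, -, t5, t6⟩ := ht
      simp [s1, s2, s3, s5, s6, t1, t2, t3, t5, t6, e1, e2, e3] at c1 c2 c3 c4

theorem not_dvd_sub (h : LocalConditions p m n) (hp : p.Prime) (hmod : p % 24 = 7)
    (hk : ValParities p m n 0 0 0 1 0 0) (h1 : ¬ (p : ℤ) ∣ n) (h2 : ¬ (p : ℤ) ∣ m)
    (h3 : ¬ (p : ℤ) ∣ m + n) (h5 : ¬ (p : ℤ) ∣ m + 2 * n) (h6 : ¬ (p : ℤ) ∣ m - 2 * n) :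
    ¬ (p : ℤ) ∣ m - n := by
  intro hd
  have := Fact.mk hp
  obtain ⟨hs, ht⟩ := h.signs_and_three_of_dvd_sub hmod hd h1 h2 h3 h5 h6
  rcases h.two with ⟨hn, hm, hi⟩ | ⟨hn, hm, hi⟩ | ⟨hn, hm, hi⟩ | ⟨hn, hm, hi⟩ | ⟨hn, hm, hi⟩ <;>
  obtain ⟨z₁, z₂, z₃, z₄, z₅, z₆, hz₁, hz₂, hz₃, hz₄, hz₅, hz₆, e₁, e₂, e₃, e₄, e₅, e₆⟩ :=
    h.exists_eq hp (by omega) (by omega) hs (by decide) ht hk hi <;>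
  simp only [pow_zero, pow_one, one_mul, neg_mul] at e₁ e₂ e₃ e₄ e₅ e₆
  · have := Int.sq_emod_eight z₁
    have := Int.sq_emod_eight z₂
    have := Int.sq_emod_eight z₆
    omega
  · exact hz₄ (eq_zero_of_sq_add_sq_sub_six_mul_prime hp hmod (a := z₁) (e := z₆) (b := z₂)
      (by linarith) (by linarith))
  · have := Int.sq_emod_eight z₁
    have := Int.sq_emod_eight z₄
    have := Int.sq_emod_eight z₆
    have := Int.natCast_mul_emod_eight_of_seven_mod hmod (z₄ ^ 2)
    omega
  · have := Int.sq_emod_eight z₁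
    have := Int.sq_emod_eight z₃
    omega
  · have := Int.sq_emod_eight z₁
    have := Int.sq_emod_eight z₃
    omega

theorem signs_and_three_of_dvd_add_two_mul [Fact p.Prime] (h : LocalConditions p m n)
    (hmod : p % 24 = 7) (hd : (p : ℤ) ∣ m + 2 * n) (h1 : ¬ (p : ℤ) ∣ n) (h2 : ¬ (p : ℤ) ∣ m)
    (h3 : ¬ (p : ℤ) ∣ m + n) (h4 : ¬ (p : ℤ) ∣ m - n) :
    Signs m n 1 (-1) (-1) (-1) 1 (-1) ∧ ValParities 3 m n 0 0 0 1 1 0 := by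
  have e1 := legendreSym.neg_one_of_seven_mod hmod
  have e2 := legendreSym.two_of_seven_mod hmod
  have e3 := legendreSym.three_of_seven_mod hmod
  obtain ⟨g1, g2, g3, g4, -, -⟩ := h.legendreSym_eq hmod
  have c1 := legendreSym.eq_mul_of_eq_add_mul (x := m + n) (c := -1) (y := n)
    hd 1 (by ring)
  rw [g3 h3, g1 h1] at c1
  have c2 := legendreSym.eq_mul_of_eq_add_mul (x := m) (c := 2) (y := m + n)
    hd (-1) (by ring)
  rw [g2 h2, g3 h3] at c2
  have c3 := legendreSym.eq_mul_of_eq_add_mul (x := m - n) (c := 3) (y := m + n)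
    hd (-2) (by ring)
  rw [g4 h4, g3 h3] at c3
  rcases h.signs with hs | hs | hs <;> rcases h.three with ht | ht | ht <;>
    first
    | exact ⟨hs, ht⟩
    | exfalso
      obtain ⟨s1, s2, s3, s4, -, -⟩ := hs
      obtain ⟨t1, t2, t3, t4, -, -⟩ := ht
      simp [s1, s2, s3, s4, t1, t2, t3, t4, e1, e2, e3] at c1 c2 c3

theorem not_dvd_add_two_mul (h : LocalConditions p m n) (hp : p.Prime) (hmod : p % 24 = 7)
    (hk : ValParities p m n 0 0 0 0 1 0) (h1 : ¬ (p : ℤ) ∣ n) (h2 : ¬ (p : ℤ) ∣ m)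
    (h3 : ¬ (p : ℤ) ∣ m + n) (h4 : ¬ (p : ℤ) ∣ m - n) :
    ¬ (p : ℤ) ∣ m + 2 * n := by
  intro hd
  have := Fact.mk hp
  obtain ⟨hs, ht⟩ := h.signs_and_three_of_dvd_add_two_mul hmod hd h1 h2 h3 h4
  rcases h.two with ⟨hn, hm, hi⟩ | ⟨hn, hm, hi⟩ | ⟨hn, hm, hi⟩ | ⟨hn, hm, hi⟩ | ⟨hn, hm, hi⟩ <;>
  obtain ⟨z₁, z₂, z₃, z₄, z₅, z₆, hz₁, hz₂, hz₃, hz₄, hz₅, hz₆, e₁, e₂, e₃, e₄, e₅, e₆⟩ :=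
    h.exists_eq hp (by omega) (by omega) hs (by decide) ht hk hi <;>
  simp only [pow_zero, pow_one, one_mul, neg_mul] at e₁ e₂ e₃ e₄ e₅ e₆
  · have := Int.sq_emod_eight z₁
    have := Int.sq_emod_eight z₂
    have := Int.sq_emod_eight z₄
    omega
  · have := Int.sq_emod_eight z₁
    have := Int.sq_emod_eight z₂
    have := Int.sq_emod_eight z₆
    omega
  · have := Int.sq_emod_eight z₁
    have := Int.sq_emod_eight z₃
    omega
  · exact hz₅ (eq_zero_of_sq_add_sq_sub_six_mul_prime hp hmod (a := z₆) (e := 2 * z₁)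
      (b := 2 * z₂) (by linarith) (by linarith))
  · have := Int.sq_emod_eight z₁
    have := Int.sq_emod_eight z₂
    have := Int.sq_emod_eight z₆
    omega

theorem signs_and_three_of_dvd_sub_two_mul [Fact p.Prime] (h : LocalConditions p m n)
    (hmod : p % 24 = 7) (hd : (p : ℤ) ∣ m - 2 * n) (h1 : ¬ (p : ℤ) ∣ n) (h2 : ¬ (p : ℤ) ∣ m)
    (h3 : ¬ (p : ℤ) ∣ m + n) (h4 : ¬ (p : ℤ) ∣ m - n) :
    Signs m n 1 1 1 1 1 1 ∧ ValParities 3 m n 0 0 1 0 0 1 := by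
  have e2 := legendreSym.two_of_seven_mod hmod
  have e3 := legendreSym.three_of_seven_mod hmod
  obtain ⟨g1, g2, g3, g4, -, -⟩ := h.legendreSym_eq hmod
  have c1 := legendreSym.eq_mul_of_eq_add_mul (x := m) (c := 2) (y := n)
    hd 1 (by ring)
  rw [g2 h2, g1 h1] at c1
  have c2 := legendreSym.eq_mul_of_eq_add_mul (x := m + n) (c := 3) (y := n)
    hd 1 (by ring)
  rw [g3 h3, g1 h1] at c2
  have c3 := legendreSym.eq_mul_of_eq_add_mul (x := m - n) (c := 1) (y := n)
    hd 1 (by ring)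
  rw [g4 h4, g1 h1] at c3
  rcases h.signs with hs | hs | hs <;> rcases h.three with ht | ht | ht <;>
    first
    | exact ⟨hs, ht⟩
    | exfalso
      obtain ⟨s1, s2, s3, s4, -, -⟩ := hs
      obtain ⟨t1, t2, t3, t4, -, -⟩ := ht
      simp [s1, s2, s3, s4, t1, t2, t3, t4, e2, e3] at c1 c2 c3

theorem not_dvd_sub_two_mul (h : LocalConditions p m n) (hp : p.Prime) (hmod : p % 24 = 7)
    (hk : ValParities p m n 0 0 0 0 0 1) (h1 : ¬ (p : ℤ) ∣ n) (h2 : ¬ (p : ℤ) ∣ m)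
    (h3 : ¬ (p : ℤ) ∣ m + n) (h4 : ¬ (p : ℤ) ∣ m - n) :
    ¬ (p : ℤ) ∣ m - 2 * n := by
  intro hd
  have := Fact.mk hp
  obtain ⟨hs, ht⟩ := h.signs_and_three_of_dvd_sub_two_mul hmod hd h1 h2 h3 h4
  rcases h.two with ⟨hn, hm, hi⟩ | ⟨hn, hm, hi⟩ | ⟨hn, hm, hi⟩ | ⟨hn, hm, hi⟩ | ⟨hn, hm, hi⟩ <;>
  obtain ⟨z₁, z₂, z₃, z₄, z₅, z₆, hz₁, hz₂, hz₃, hz₄, hz₅, hz₆, e₁, e₂, e₃, e₄, e₅, e₆⟩ :=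
    h.exists_eq hp (by omega) (by omega) hs (by decide) ht hk hi <;>
  simp only [pow_zero, pow_one, one_mul] at e₁ e₂ e₃ e₄ e₅ e₆
  · have := Int.sq_emod_eight z₁
    have := Int.sq_emod_eight z₂
    have := Int.sq_emod_eight z₃
    omega
  · have := Int.sq_emod_eight z₁
    have := Int.sq_emod_eight z₂
    have := Int.sq_emod_eight z₅
    omega
  · have := Int.sq_emod_eight z₁
    have := Int.sq_emod_eight z₄
    omega
  · have := Int.sq_emod_eight z₁
    have := Int.sq_emod_eight z₂
    have := Int.sq_emod_eight z₅
    omega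
  · exact hz₆ (eq_zero_of_sq_add_sq_sub_six_mul_prime hp hmod (a := z₅) (e := 2 * z₂)
      (b := 2 * z₁) (by linarith) (by linarith))

end LocalConditions

theorem Int.val_two_eq_one {x : ℤ} (h : x % 4 = 2) : Int.val 2 x = 1 := by
  have hx : x ≠ 0 := by rintro rfl; simp at h
  have h1 := (Int.pow_dvd_iff_le_val Nat.prime_two hx 1).mp (by push_cast; omega)
  have h2 := (Int.pow_dvd_iff_le_val Nat.prime_two hx 2).not.mp (by push_cast; omega)
  omega

theorem Int.val_two_eq_two {x : ℤ} (h : x % 8 = 4) : Int.val 2 x = 2 := by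
  have hx : x ≠ 0 := by rintro rfl; simp at h
  have h1 := (Int.pow_dvd_iff_le_val Nat.prime_two hx 2).mp (by push_cast; omega)
  have h2 := (Int.pow_dvd_iff_le_val Nat.prime_two hx 3).not.mp (by push_cast; omega)
  omega

theorem Int.val_three_eq_one {x : ℤ} (h : x % 3 = 0) (h9 : x % 9 ≠ 0) : Int.val 3 x = 1 := by
  have hx : x ≠ 0 := by rintro rfl; simp at h9
  have h1 := (Int.pow_dvd_iff_le_val Nat.prime_three hx 1).mp (by push_cast; omega)
  have h2 := (Int.pow_dvd_iff_le_val Nat.prime_three hx 2).not.mp (by push_cast; omega)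
  omega

section

variable {p : ℕ} {m n v : ℤ}

theorem val_add_val_eq_of_eq_prime_mul_sq (hp : p.Prime) (hv : v ≠ 0)
    (h : n * m * (m + n) * (m - n) * (m + 2 * n) * (m - 2 * n) = p * v ^ 2) (q : ℕ) :
    Int.val q n + Int.val q m + Int.val q (m + n) + Int.val q (m - n) + Int.val q (m + 2 * n) +
      Int.val q (m - 2 * n) = (if p = q then 1 else 0) + 2 * Int.val q v := by
  have hp0 : (p : ℤ) ≠ 0 := by exact_mod_cast hp.ne_zero
  have h0 : n * m * (m + n) * (m - n) * (m + 2 * n) * (m - 2 * n) ≠ 0 := by rw [h]; positivity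
  have h1 := left_ne_zero_of_mul h0
  have h2 := left_ne_zero_of_mul h1
  have h3 := left_ne_zero_of_mul h2
  have h4 := left_ne_zero_of_mul h3
  have := congrArg (Int.val q) h
  rwa [Int.val_mul q h1 (right_ne_zero_of_mul h0), Int.val_mul q h2 (right_ne_zero_of_mul h1),
    Int.val_mul q h3 (right_ne_zero_of_mul h2), Int.val_mul q h4 (right_ne_zero_of_mul h3),
    Int.val_mul q (left_ne_zero_of_mul h4) (right_ne_zero_of_mul h4),
    Int.val_mul q hp0 (by positivity), Int.val_sq, Int.val_natCast_prime hp] at this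

/-- A prime other than `2` and `3` divides at most one of the six linear forms. -/
theorem val_eq_zero_of_ne_two_of_ne_three (hmn : IsCoprime m n) {q : ℕ} (hq : q.Prime)
    (hq2 : q ≠ 2) (hq3 : q ≠ 3) :
    (Int.val q m = 0 ∧ Int.val q (m + n) = 0 ∧ Int.val q (m - n) = 0 ∧
      Int.val q (m + 2 * n) = 0 ∧ Int.val q (m - 2 * n) = 0) ∨
    (Int.val q n = 0 ∧ Int.val q (m + n) = 0 ∧ Int.val q (m - n) = 0 ∧
      Int.val q (m + 2 * n) = 0 ∧ Int.val q (m - 2 * n) = 0) ∨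
    (Int.val q n = 0 ∧ Int.val q m = 0 ∧ Int.val q (m - n) = 0 ∧ Int.val q (m + 2 * n) = 0 ∧
      Int.val q (m - 2 * n) = 0) ∨
    (Int.val q n = 0 ∧ Int.val q m = 0 ∧ Int.val q (m + n) = 0 ∧ Int.val q (m + 2 * n) = 0 ∧
      Int.val q (m - 2 * n) = 0) ∨
    (Int.val q n = 0 ∧ Int.val q m = 0 ∧ Int.val q (m + n) = 0 ∧ Int.val q (m - n) = 0 ∧
      Int.val q (m - 2 * n) = 0) ∨
    (Int.val q n = 0 ∧ Int.val q m = 0 ∧ Int.val q (m + n) = 0 ∧ Int.val q (m - n) = 0 ∧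
      Int.val q (m + 2 * n) = 0) := by
  have hi : Prime (q : ℤ) := Nat.prime_iff_prime_int.mp hq
  have h1 : ¬ (q : ℤ) ∣ 1 := hi.not_dvd_one
  have h2 : ¬ (q : ℤ) ∣ 2 := fun hd ↦
    hq2 ((Nat.prime_dvd_prime_iff_eq hq Nat.prime_two).mp (by exact_mod_cast hd))
  have h3 : ¬ (q : ℤ) ∣ 3 := fun hd ↦
    hq3 ((Nat.prime_dvd_prime_iff_eq hq Nat.prime_three).mp (by exact_mod_cast hd))
  have h4 : ¬ (q : ℤ) ∣ 4 := fun hd ↦ h2 (hi.dvd_of_dvd_pow (n := 2) (by norm_num; exact hd))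
  have key {x y : ℤ} (a b a' b' : ℤ) := Int.val_eq_zero_or_val_eq_zero (q := q) (x := x) (y := y)
    hmn a b a' b'
  have r12 : Int.val q n = 0 ∨ Int.val q m = 0 :=
    key 0 1 1 0 (by ring) (by ring) (by norm_num; assumption)
  have r13 : Int.val q n = 0 ∨ Int.val q (m + n) = 0 :=
    key 0 1 1 1 (by ring) (by ring) (by norm_num; assumption)
  have r14 : Int.val q n = 0 ∨ Int.val q (m - n) = 0 :=
    key 0 1 1 (-1) (by ring) (by ring) (by norm_num; assumption)
  have r15 : Int.val q n = 0 ∨ Int.val q (m + 2 * n) = 0 :=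
    key 0 1 1 2 (by ring) (by ring) (by norm_num; assumption)
  have r16 : Int.val q n = 0 ∨ Int.val q (m - 2 * n) = 0 :=
    key 0 1 1 (-2) (by ring) (by ring) (by norm_num; assumption)
  have r23 : Int.val q m = 0 ∨ Int.val q (m + n) = 0 :=
    key 1 0 1 1 (by ring) (by ring) (by norm_num; assumption)
  have r24 : Int.val q m = 0 ∨ Int.val q (m - n) = 0 :=
    key 1 0 1 (-1) (by ring) (by ring) (by norm_num; assumption)
  have r25 : Int.val q m = 0 ∨ Int.val q (m + 2 * n) = 0 :=
    key 1 0 1 2 (by ring) (by ring) (by norm_num; assumption)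
  have r26 : Int.val q m = 0 ∨ Int.val q (m - 2 * n) = 0 :=
    key 1 0 1 (-2) (by ring) (by ring) (by norm_num; assumption)
  have r34 : Int.val q (m + n) = 0 ∨ Int.val q (m - n) = 0 :=
    key 1 1 1 (-1) (by ring) (by ring) (by norm_num; assumption)
  have r35 : Int.val q (m + n) = 0 ∨ Int.val q (m + 2 * n) = 0 :=
    key 1 1 1 2 (by ring) (by ring) (by norm_num; assumption)
  have r36 : Int.val q (m + n) = 0 ∨ Int.val q (m - 2 * n) = 0 :=
    key 1 1 1 (-2) (by ring) (by ring) (by norm_num; assumption)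
  have r45 : Int.val q (m - n) = 0 ∨ Int.val q (m + 2 * n) = 0 :=
    key 1 (-1) 1 2 (by ring) (by ring) (by norm_num; assumption)
  have r46 : Int.val q (m - n) = 0 ∨ Int.val q (m - 2 * n) = 0 :=
    key 1 (-1) 1 (-2) (by ring) (by ring) (by norm_num; assumption)
  have r56 : Int.val q (m + 2 * n) = 0 ∨ Int.val q (m - 2 * n) = 0 :=
    key 1 2 1 (-2) (by ring) (by ring) (by norm_num; assumption)
  by_cases e1 : Int.val q n = 0
  · by_cases e2 : Int.val q m = 0
    · by_cases e3 : Int.val q (m + n) = 0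
      · by_cases e4 : Int.val q (m - n) = 0
        · by_cases e5 : Int.val q (m + 2 * n) = 0
          · simp [*]
          · simp_all
        · simp_all
      · simp_all
    · simp_all
  · simp_all

theorem signs_of_pos (hn : 0 < n)
    (h : 0 < n * m * (m + n) * (m - n) * (m + 2 * n) * (m - 2 * n)) :
    Signs m n 1 1 1 1 1 1 ∨ Signs m n 1 1 1 (-1) 1 (-1) ∨
      Signs m n 1 (-1) (-1) (-1) 1 (-1) := by
  have hs := Int.sign_eq_one_of_pos h
  have h1 := left_ne_zero_of_mul h.ne'
  have h2 := left_ne_zero_of_mul h1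
  have h3 := left_ne_zero_of_mul h2
  have h4 := left_ne_zero_of_mul h3
  have sgn {x : ℤ} (hx : x ≠ 0) : 0 < x ∧ x.sign = 1 ∨ x < 0 ∧ x.sign = -1 := by
    rcases lt_or_gt_of_ne hx with hx | hx
    · exact .inr ⟨hx, Int.sign_eq_neg_one_of_neg hx⟩
    · exact .inl ⟨hx, Int.sign_eq_one_of_pos hx⟩
  simp only [Int.sign_mul] at hs
  unfold Signs
  have e1 := Int.sign_eq_one_of_pos hn
  rcases sgn (right_ne_zero_of_mul h4) with ⟨g2, e2⟩ | ⟨g2, e2⟩ <;>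
  rcases sgn (right_ne_zero_of_mul h3) with ⟨g3, e3⟩ | ⟨g3, e3⟩ <;>
  rcases sgn (right_ne_zero_of_mul h2) with ⟨g4, e4⟩ | ⟨g4, e4⟩ <;>
  rcases sgn (right_ne_zero_of_mul h1) with ⟨g5, e5⟩ | ⟨g5, e5⟩ <;>
  rcases sgn (right_ne_zero_of_mul h.ne') with ⟨g6, e6⟩ | ⟨g6, e6⟩ <;>
  first
  | omega
  | (rw [e1, e2, e3, e4, e5, e6] at hs; exact absurd hs (by decide))

theorem valParities_two (hmn : IsCoprime m n)
    (hsum : (Int.val 2 n + Int.val 2 m + Int.val 2 (m + n) + Int.val 2 (m - n) +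
      Int.val 2 (m + 2 * n) + Int.val 2 (m - 2 * n)) % 2 = 0) :
    (n % 2 = 0 ∧ m % 2 = 1 ∧ ValParities 2 m n 0 0 0 0 0 0) ∨
    (n % 2 = 1 ∧ m % 2 = 1 ∧ ValParities 2 m n 0 0 1 1 0 0) ∨
    (n % 2 = 1 ∧ m % 4 = 0 ∧ ValParities 2 m n 0 0 0 0 1 1) ∨
    (n % 2 = 1 ∧ m % 4 = 2 ∧ ValParities 2 m n 0 1 0 0 1 0) ∨
    (n % 2 = 1 ∧ m % 4 = 2 ∧ ValParities 2 m n 0 1 0 0 0 1) := by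
  have hodd : ¬ (m % 2 = 0 ∧ n % 2 = 0) := by
    rintro ⟨h3, h4⟩
    have := hmn.isUnit_of_dvd' (Int.dvd_of_emod_eq_zero h3) (Int.dvd_of_emod_eq_zero h4)
    exact absurd this (by decide)
  have odd {x : ℤ} (hx : x % 2 = 1) : Int.val 2 x = 0 := Int.val_eq_zero (by push_cast; omega)
  obtain hn | hn := Int.emod_two_eq_zero_or_one n
  · have h1 := odd (x := m) (by omega)
    have h2 := odd (x := m + n) (by omega)
    have h3 := odd (x := m - n) (by omega)
    have h4 := odd (x := m + 2 * n) (by omega)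
    have h5 := odd (x := m - 2 * n) (by omega)
    rw [h1, h2, h3, h4, h5] at hsum
    exact .inl ⟨hn, by omega, hsum, by rw [h1], by rw [h2], by rw [h3], by rw [h4], by rw [h5]⟩
  have h1 := odd hn
  obtain hm | hm := Int.emod_two_eq_zero_or_one m
  · have h2 := odd (x := m + n) (by omega)
    have h3 := odd (x := m - n) (by omega)
    obtain hm4 | hm4 : m % 4 = 0 ∨ m % 4 = 2 := by omega
    · have h4 := Int.val_two_eq_one (x := m + 2 * n) (by omega)
      have h5 := Int.val_two_eq_one (x := m - 2 * n) (by omega)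
      rw [h1, h2, h3, h4, h5] at hsum
      exact .inr <| .inr <| .inl ⟨hn, hm4, by rw [h1], by omega, by rw [h2], by rw [h3],
        by rw [h4], by rw [h5]⟩
    · have h6 := Int.val_two_eq_one hm4
      obtain h8 | h8 : (m + 2 * n) % 8 = 4 ∨ (m - 2 * n) % 8 = 4 := by omega
      · have h4 := Int.val_two_eq_two h8
        rw [h1, h2, h3, h4, h6] at hsum
        exact .inr <| .inr <| .inr <| .inr ⟨hn, hm4, by rw [h1], by rw [h6], by rw [h2], by rw [h3],
          by rw [h4], by omega⟩
      · have h5 := Int.val_two_eq_two h8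
        rw [h1, h2, h3, h5, h6] at hsum
        exact .inr <| .inr <| .inr <| .inl ⟨hn, hm4, by rw [h1], by rw [h6], by rw [h2], by rw [h3],
          by omega, by rw [h5]⟩
  · have h2 := odd hm
    have h3 := odd (x := m + 2 * n) (by omega)
    have h4 := odd (x := m - 2 * n) (by omega)
    rw [h1, h2, h3, h4] at hsum
    refine .inr <| .inl ⟨hn, hm, by rw [h1], by rw [h2], ?_, ?_, by rw [h3], by rw [h4]⟩ <;>
    obtain h4 | h4 : (m + n) % 4 = 2 ∨ (m - n) % 4 = 2 := by omega
    all_goals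
      have h5 := Int.val_two_eq_one h4
      omega

theorem valParities_three (hmn : IsCoprime m n)
    (hsum : (Int.val 3 n + Int.val 3 m + Int.val 3 (m + n) + Int.val 3 (m - n) +
      Int.val 3 (m + 2 * n) + Int.val 3 (m - 2 * n)) % 2 = 0) :
    ValParities 3 m n 0 0 0 0 0 0 ∨ ValParities 3 m n 0 0 0 1 1 0 ∨
      ValParities 3 m n 0 0 1 0 0 1 := by
  have zero {x : ℤ} (hx : x % 3 ≠ 0) : Int.val 3 x = 0 := Int.val_eq_zero (by push_cast; omega)
  by_cases hn : n % 3 = 0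
  · have hm : m % 3 ≠ 0 := by
      intro hm
      have := hmn.isUnit_of_dvd' (Int.dvd_of_emod_eq_zero hm) (Int.dvd_of_emod_eq_zero hn)
      exact absurd this (by decide)
    have h1 := zero hm
    have h2 := zero (x := m + n) (by omega)
    have h3 := zero (x := m - n) (by omega)
    have h4 := zero (x := m + 2 * n) (by omega)
    have h5 := zero (x := m - 2 * n) (by omega)
    rw [h1, h2, h3, h4, h5] at hsum
    exact .inl ⟨hsum, by rw [h1], by rw [h2], by rw [h3], by rw [h4], by rw [h5]⟩
  have h1 := zero hn
  by_cases hm : m % 3 = 0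
  · have h2 := zero (x := m + n) (by omega)
    have h3 := zero (x := m - n) (by omega)
    have h4 := zero (x := m + 2 * n) (by omega)
    have h5 := zero (x := m - 2 * n) (by omega)
    rw [h1, h2, h3, h4, h5] at hsum
    exact .inl ⟨by rw [h1], by omega, by rw [h2], by rw [h3], by rw [h4], by rw [h5]⟩
  have h2 := zero hm
  by_cases h : (m - n) % 3 = 0
  · have h3 := zero (x := m + n) (by omega)
    have h4 := zero (x := m - 2 * n) (by omega)
    rw [h1, h2, h3, h4] at hsum
    refine .inr <| .inl ⟨by rw [h1], by rw [h2], by rw [h3], ?_, ?_, by rw [h4]⟩ <;>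
    obtain h9 | h9 : (m - n) % 9 ≠ 0 ∨ (m + 2 * n) % 9 ≠ 0 := by omega
    all_goals
      have h5 := Int.val_three_eq_one (by omega) h9
      omega
  · have h' : (m + n) % 3 = 0 := by
      obtain hm | hm : m % 3 = 1 ∨ m % 3 = 2 := by omega
      all_goals omega
    have h3 := zero h
    have h4 := zero (x := m + 2 * n) (by omega)
    rw [h1, h2, h3, h4] at hsum
    refine .inr <| .inr ⟨by rw [h1], by rw [h2], ?_, by rw [h3], by rw [h4], ?_⟩ <;>
    obtain h9 | h9 : (m + n) % 9 ≠ 0 ∨ (m - 2 * n) % 9 ≠ 0 := by omega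
    all_goals
      have h5 := Int.val_three_eq_one (by omega) h9
      omega

theorem LocalConditions.of_eq_prime_mul_sq (hp : p.Prime) (hp2 : p ≠ 2) (hp3 : p ≠ 3)
    (hn : 0 < n) (hmn : IsCoprime m n) (hv : v ≠ 0)
    (h : n * m * (m + n) * (m - n) * (m + 2 * n) * (m - 2 * n) = p * v ^ 2) :
    LocalConditions p m n where
  pos := hn
  coprime := hmn
  even q hq hq2 hq3 hqp := by
    have hsum := val_add_val_eq_of_eq_prime_mul_sq hp hv h q
    rw [if_neg hqp.symm] at hsum
    rcases val_eq_zero_of_ne_two_of_ne_three hmn hq hq2 hq3 with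
      ⟨h1, h2, h3, h4, h5⟩ | ⟨h1, h2, h3, h4, h5⟩ | ⟨h1, h2, h3, h4, h5⟩ |
      ⟨h1, h2, h3, h4, h5⟩ | ⟨h1, h2, h3, h4, h5⟩ | ⟨h1, h2, h3, h4, h5⟩ <;>
    simp only [h1, h2, h3, h4, h5] at hsum <;> simp [ValParities, h1, h2, h3, h4, h5] <;> omega
  signs := by
    have := hp.pos
    exact signs_of_pos hn (by rw [h]; positivity)
  three := by
    have := val_add_val_eq_of_eq_prime_mul_sq hp hv h 3
    rw [if_neg hp3] at this
    exact valParities_three hmn (by omega)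
  two := by
    have := val_add_val_eq_of_eq_prime_mul_sq hp hv h 2
    rw [if_neg hp2] at this
    exact valParities_two hmn (by omega)

theorem false_of_eq_prime_mul_sq (hp : p.Prime) (hmod : p % 24 = 7)
    (hn : 0 < n) (hmn : IsCoprime m n) (hv : v ≠ 0)
    (h : n * m * (m + n) * (m - n) * (m + 2 * n) * (m - 2 * n) = p * v ^ 2) : False := by
  have hl := LocalConditions.of_eq_prime_mul_sq hp (by omega) (by omega) hn hmn hv h
  have hsum := val_add_val_eq_of_eq_prime_mul_sq hp hv h p
  rw [if_pos rfl] at hsum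
  have hp0 : (p : ℤ) ≠ 0 := by exact_mod_cast hp.ne_zero
  have h0 : n * m * (m + n) * (m - n) * (m + 2 * n) * (m - 2 * n) ≠ 0 := by rw [h]; positivity
  have h1 := left_ne_zero_of_mul h0
  have h2 := left_ne_zero_of_mul h1
  have h3 := left_ne_zero_of_mul h2
  have h4 := left_ne_zero_of_mul h3
  have d1 := Int.dvd_iff_one_le_val hp (left_ne_zero_of_mul h4)
  have d2 := Int.dvd_iff_one_le_val hp (right_ne_zero_of_mul h4)
  have d3 := Int.dvd_iff_one_le_val hp (right_ne_zero_of_mul h3)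
  have d4 := Int.dvd_iff_one_le_val hp (right_ne_zero_of_mul h2)
  have d5 := Int.dvd_iff_one_le_val hp (right_ne_zero_of_mul h1)
  have d6 := Int.dvd_iff_one_le_val hp (right_ne_zero_of_mul h0)
  rcases val_eq_zero_of_ne_two_of_ne_three hmn hp (by omega) (by omega) with
    ⟨h1, h2, h3, h4, h5⟩ | ⟨h1, h2, h3, h4, h5⟩ | ⟨h1, h2, h3, h4, h5⟩ |
    ⟨h1, h2, h3, h4, h5⟩ | ⟨h1, h2, h3, h4, h5⟩ | ⟨h1, h2, h3, h4, h5⟩ <;>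
  simp only [h1, h2, h3, h4, h5] at hsum d1 d2 d3 d4 d5 d6
  · exact hl.not_dvd_right hp hmod ⟨by omega, by simp [*], by simp [*], by simp [*], by simp [*],
      by simp [*]⟩
      (by simp [d2]) (by simp [d3]) (by simp [d4]) (by simp [d5])
      (d1.mpr (by omega))
  · exact hl.not_dvd_left hp hmod ⟨by simp [*], by omega, by simp [*], by simp [*], by simp [*],
      by simp [*]⟩
      (by simp [d1]) (by simp [d3]) (by simp [d4]) (by simp [d5]) (by simp [d6])
      (d2.mpr (by omega))
  · exact hl.not_dvd_add hp hmod ⟨by simp [*], by simp [*], by omega, by simp [*], by simp [*],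
      by simp [*]⟩
      (by simp [d1]) (by simp [d2]) (by simp [d4]) (by simp [d6])
      (d3.mpr (by omega))
  · exact hl.not_dvd_sub hp hmod ⟨by simp [*], by simp [*], by simp [*], by omega, by simp [*],
      by simp [*]⟩
      (by simp [d1]) (by simp [d2]) (by simp [d3]) (by simp [d5]) (by simp [d6])
      (d4.mpr (by omega))
  · exact hl.not_dvd_add_two_mul hp hmod ⟨by simp [*], by simp [*], by simp [*], by simp [*],
      by omega, by simp [*]⟩
      (by simp [d1]) (by simp [d2]) (by simp [d3]) (by simp [d4])
      (d5.mpr (by omega))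
  · exact hl.not_dvd_sub_two_mul hp hmod ⟨by simp [*], by simp [*], by simp [*], by simp [*],
      by simp [*], by omega⟩
      (by simp [d1]) (by simp [d2]) (by simp [d3]) (by simp [d4])
      (d6.mpr (by omega))

end

theorem Rat.exists_intCast_eq_of_sq_eq_intCast {w : ℚ} {k : ℤ} (h : w ^ 2 = k) :
    ∃ z : ℤ, w = z := by
  have hd := congrArg Rat.den h
  rw [Rat.den_pow, Rat.den_intCast] at hd
  exact ⟨w.num, (Rat.coe_int_num_of_den_eq_one (by simpa using hd)).symm⟩

/-- For a prime `p ≡ 7 (mod 24)`, every rational point on the genus 2 curve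
`C_p : y² = x(x² − p²)(x² − 4p²)` satisfies `y = 0`, hence `x ∈ {0, ±p, ±2p}`;
i.e. the rational points of `C_p` are exactly its six Weierstrass points. -/
theorem rational_points_Cp_of_seven_mod_24 (p : ℕ) (hp : Nat.Prime p) (hmod : p % 24 = 7)
    (x y : ℚ) (h : y ^ 2 = x * (x ^ 2 - (p : ℚ) ^ 2) * (x ^ 2 - 4 * (p : ℚ) ^ 2)) :
    y = 0 ∧ (x = 0 ∨ x = p ∨ x = -p ∨ x = 2 * p ∨ x = -(2 * p)) := by
  have hp0 : (p : ℚ) ≠ 0 := by exact_mod_cast hp.ne_zero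
  have hy : y = 0 := by
    by_contra hy
    set t : ℚ := x / p with ht
    have hx : x = p * t := by rw [ht]; field_simp
    have hn : (t.den : ℚ) ≠ 0 := by exact_mod_cast t.den_ne_zero
    have htn : t * t.den = t.num := Rat.mul_den_eq_num t
    have hw : (y * t.den ^ 3 / p ^ 2) ^ 2 = ((p * (t.den * t.num * (t.num + t.den) *
        (t.num - t.den) * (t.num + 2 * t.den) * (t.num - 2 * t.den)) : ℤ) : ℚ) := by
      push_cast
      rw [← htn, div_pow, mul_pow, h, hx]
      field_simp
      ring
    obtain ⟨w, hwz⟩ := Rat.exists_intCast_eq_of_sq_eq_intCast hw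
    have hw0 : w ≠ 0 := by
      rintro rfl
      have : y * t.den ^ 3 / p ^ 2 ≠ 0 := by positivity
      exact this (by rw [hwz]; simp)
    rw [hwz] at hw
    have hw' : w ^ 2 = p * (t.den * t.num * (t.num + t.den) *
        (t.num - t.den) * (t.num + 2 * t.den) * (t.num - 2 * t.den)) := by exact_mod_cast hw
    obtain ⟨v, rfl⟩ : (p : ℤ) ∣ w :=
      (Nat.prime_iff_prime_int.mp hp).dvd_of_dvd_pow (n := 2) (hw' ▸ dvd_mul_right _ _)
    have hpz : (p : ℤ) ≠ 0 := by exact_mod_cast hp.ne_zero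
    refine false_of_eq_prime_mul_sq hp hmod (m := t.num) (n := t.den) (v := v)
      (by exact_mod_cast t.den_pos) ?_ (right_ne_zero_of_mul hw0) ?_
    · rw [Int.isCoprime_iff_nat_coprime]
      simpa using t.reduced
    · apply mul_left_cancel₀ hpz
      rw [← hw']
      ring
  refine ⟨hy, ?_⟩
  have h0 : x * ((x - p) * ((x + p) * ((x - 2 * p) * (x + 2 * p)))) = 0 := by
    rw [hy] at h
    linear_combination -h
  rcases mul_eq_zero.mp h0 with h0 | h0
  · exact .inl h0
  rcases mul_eq_zero.mp h0 with h0 | h0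
  · exact .inr <| .inl (by linarith)
  rcases mul_eq_zero.mp h0 with h0 | h0
  · exact .inr <| .inr <| .inl (by linarith)
  rcases mul_eq_zero.mp h0 with h0 | h0
  · exact .inr <| .inr <| .inr <| .inl (by linarith)
  · exact .inr <| .inr <| .inr <| .inr (by linarith)
end

section
/- Let p be a prime number with p ≡ 17 (mod 24) such that 2 is not a fourth power modulo p, i.e. there is no z ∈ 𝔽_p with z⁴ = 2 (this is equivalent to p not splitting completely in ℚ(2^{1/4})). Then every rational solution (x, y) ∈ ℚ × ℚ of y² = x(x² − p²)(x² − 4p²) satisfies y = 0 (hence x ∈ {0, p, −p, 2p, −2p}). -/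
/-- The exponent of `q` in the integer `x`. -/
def expo (q : ℕ) (x : ℤ) : ℕ := x.natAbs.factorization q

lemma expo_mul (q : ℕ) {x y : ℤ} (hx : x ≠ 0) (hy : y ≠ 0) :
    expo q (x * y) = expo q x + expo q y := by
  simp [expo, Int.natAbs_mul,
    Nat.factorization_mul (Int.natAbs_ne_zero.2 hx) (Int.natAbs_ne_zero.2 hy)]

lemma expo_eq_zero {q : ℕ} {x : ℤ} (h : ¬ (q : ℤ) ∣ x) : expo q x = 0 :=
  Nat.factorization_eq_zero_of_not_dvd fun h' => h (Int.natCast_dvd.2 h')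

lemma expo_prime {q r : ℕ} (hq : q.Prime) : expo r q = if q = r then 1 else 0 := by
  simp [expo, hq.factorization, Finsupp.single_apply]

lemma expo_sq (q : ℕ) (x : ℤ) : expo q (x ^ 2) = 2 * expo q x := by
  simp [expo, Int.natAbs_pow]

lemma expo_eq_zero_or_of_isCoprime {q : ℕ} (hq : q.Prime) {x y : ℤ} (h : IsCoprime x y) :
    expo q x = 0 ∨ expo q y = 0 := by
  by_contra! hc
  have hx : (q : ℤ) ∣ x := by_contra fun h' => hc.1 (expo_eq_zero h')
  have hy : (q : ℤ) ∣ y := by_contra fun h' => hc.2 (expo_eq_zero h')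
  exact (Nat.prime_iff_prime_int.1 hq).not_isUnit (h.isUnit_of_dvd' hx hy)

lemma exists_eq_sq_of_even_expo {x : ℤ} (hx : x ≠ 0)
    (h : ∀ q : ℕ, q.Prime → expo q x % 2 = 0) :
    ∃ ε s : ℤ, (ε = 1 ∨ ε = -1) ∧ x = ε * s ^ 2 := by
  obtain ⟨a, b, hab, ha⟩ := Nat.sq_mul_squarefree x.natAbs
  have hn : x.natAbs ≠ 0 := Int.natAbs_ne_zero.2 hx
  have hb0 : b ≠ 0 := by rintro rfl; simp at hab; omega
  have ha0 : a ≠ 0 := by rintro rfl; simp at hab; omega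
  have ha1 : a = 1 := by
    by_contra hne
    obtain ⟨q, hq, hqa⟩ := Nat.exists_prime_and_dvd hne
    have h1 := h q hq
    have h2 : a.factorization q = 1 := by
      have := ha.natFactorization_le_one q
      have := (hq.dvd_iff_one_le_factorization ha0).1 hqa
      omega
    rw [expo, ← hab, Nat.factorization_mul (by positivity) ha0, Nat.factorization_pow] at h1
    simp [h2] at h1
  subst ha1
  rcases Int.natAbs_eq x with h' | h'
  · exact ⟨1, b, Or.inl rfl, by rw [h', ← hab]; push_cast; ring⟩
  · exact ⟨-1, b, Or.inr rfl, by rw [h', ← hab]; push_cast; ring⟩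

lemma exists_eq_pow_expo_mul {q : ℕ} (hq : q.Prime) {x : ℤ} (hx : x ≠ 0) :
    ∃ y : ℤ, y ≠ 0 ∧ x = (q : ℤ) ^ (expo q x % 2) * y ∧ expo q y % 2 = 0 ∧
      ∀ r : ℕ, r ≠ q → expo r y = expo r x := by
  rcases Nat.mod_two_eq_zero_or_one (expo q x) with h | h
  · exact ⟨x, hx, by simp [h], h, fun _ _ => rfl⟩
  · have hd : (q : ℤ) ∣ x := by
      by_contra h'
      rw [expo_eq_zero h'] at h
      omega
    obtain ⟨y, rfl⟩ := hd
    have hq0 : (q : ℤ) ≠ 0 := left_ne_zero_of_mul hx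
    have hy : y ≠ 0 := right_ne_zero_of_mul hx
    refine ⟨y, hy, by simp [h], ?_, fun r hr => ?_⟩
    · rw [expo_mul q hq0 hy, expo_prime hq, if_pos rfl] at h
      omega
    · rw [expo_mul r hq0 hy, expo_prime hq, if_neg hr.symm, zero_add]

/-- Square class of an integer whose exponents are even away from `2`, `3` and `p`. -/
lemma exists_square_class {p : ℕ} (hp : p.Prime) (h2 : p ≠ 2) (h3 : p ≠ 3) {x : ℤ} (hx : x ≠ 0)
    (h : ∀ q : ℕ, q.Prime → q ≠ 2 → q ≠ 3 → q ≠ p → expo q x % 2 = 0) :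
    ∃ ε s : ℤ, (ε = 1 ∨ ε = -1) ∧
      x = ε * (2 ^ (expo 2 x % 2) * 3 ^ (expo 3 x % 2) * p ^ (expo p x % 2)) * s ^ 2 := by
  obtain ⟨y, hy, hxy, hye, hyo⟩ := exists_eq_pow_expo_mul Nat.prime_two hx
  obtain ⟨z, hz, hyz, hze, hzo⟩ := exists_eq_pow_expo_mul Nat.prime_three hy
  obtain ⟨w, hw, hzw, hwe, hwo⟩ := exists_eq_pow_expo_mul hp hz
  obtain ⟨ε, s, hε, hs⟩ := exists_eq_sq_of_even_expo hw fun q hq => by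
    by_cases q2 : q = 2
    · subst q2; rw [hwo _ h2.symm, hzo _ (by norm_num), hye]
    by_cases q3 : q = 3
    · subst q3; rw [hwo _ h3.symm, hze]
    by_cases qp : q = p
    · subst qp; exact hwe
    rw [hwo _ qp, hzo _ q3, hyo _ q2]
    exact h q hq q2 q3 qp
  refine ⟨ε, s, hε, ?_⟩
  rw [hzo _ h3, hyo _ h2, hs] at hzw
  rw [hyo 3 (by norm_num), hzw] at hyz
  rw [hyz] at hxy
  calc x = _ := hxy
    _ = _ := by push_cast; ring

/-- The numbers `a ^ 2 - b ^ 2` and `a ^ 2 - 4 * b ^ 2` are not both squares, unless `b = 0`. -/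
theorem eq_zero_of_sq_sub_sq_of_sq_sub_four_mul_sq {a b e f : ℤ} (hab : IsCoprime a b)
    (he : a ^ 2 - b ^ 2 = e ^ 2) (hf : a ^ 2 - 4 * b ^ 2 = f ^ 2) : b = 0 := by
  induction hn : b.natAbs using Nat.strong_induction_on generalizing a b e f with
  | _ n ih =>
  by_contra hb
  wlog ha : 0 < a generalizing a
  · have ha0 : a ≠ 0 := by
      rintro rfl
      have : 0 < b ^ 2 := by positivity
      nlinarith [sq_nonneg e]
    exact this hab.neg_left (by rw [← he]; ring) (by rw [← hf]; ring) (by omega)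
  have hodd : a % 2 = 1 ∧ b % 2 = 0 := by
    have h2 : ¬ (a % 2 = 0 ∧ b % 2 = 0) := fun h =>
      Int.prime_two.not_isUnit (hab.isUnit_of_dvd' (Int.dvd_of_emod_eq_zero h.1)
        (Int.dvd_of_emod_eq_zero h.2))
    have h8 : ∀ t : ℤ, t ^ 2 % 8 = 0 ∧ t % 4 = 0 ∨ t ^ 2 % 8 = 4 ∧ t % 4 = 2 ∨
        t ^ 2 % 8 = 1 ∧ t % 2 = 1 := by
      intro t
      have : t % 8 = 0 ∨ t % 8 = 1 ∨ t % 8 = 2 ∨ t % 8 = 3 ∨ t % 8 = 4 ∨ t % 8 = 5 ∨ t % 8 = 6 ∨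
        t % 8 = 7 := by omega
      rcases this with h | h | h | h | h | h | h | h <;> simp [pow_two, Int.mul_emod, h] <;> omega
    have := h8 a; have := h8 b; have := h8 e; have := h8 f
    omega
  have sq_odd : ∀ t : ℤ, t ^ 2 % 2 = 1 → t % 2 = 1 := by
    intro t ht
    rcases Int.emod_two_eq_zero_or_one t with h | h
    · simp [pow_two, Int.mul_emod, h] at ht
    · exact h
  have sq_odd' : ∀ t : ℤ, t % 2 = 1 → t ^ 2 % 4 = 1 := by
    intro t ht
    have : t % 4 = 1 ∨ t % 4 = 3 := by omega
    rcases this with h | h <;> simp [pow_two, Int.mul_emod, h]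
  have ha2 := sq_odd' a hodd.1
  have hb2 : b ^ 2 % 2 = 0 := by simp [pow_two, Int.mul_emod, hodd.2]
  have hee : e % 2 = 1 := sq_odd e (by omega)
  have hff : f % 2 = 1 := sq_odd f (by omega)
  have key : ∀ m k r s : ℤ, IsCoprime m k → IsCoprime r s → r % 2 = 0 → b = 2 * m * k →
      b = r * s → a = m ^ 2 + k ^ 2 → a = r ^ 2 + s ^ 2 → False := by
    intro m k r s hmk hrs hr h1 h2 h3 h4
    obtain ⟨r', rfl⟩ : (2 : ℤ) ∣ r := Int.dvd_of_emod_eq_zero hr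
    have hs : s % 2 = 1 := by
      by_contra hs
      exact Int.prime_two.not_isUnit (hrs.isUnit_of_dvd' (Dvd.intro _ rfl)
        (Int.dvd_of_emod_eq_zero (by omega)))
    have h5 : r' * s = m * k := by linarith
    obtain ⟨α, β, ⟨γ, rfl⟩, ⟨δ, rfl⟩, rfl⟩ := exists_dvd_and_dvd_of_dvd_mul (Dvd.intro _ h5)
    have hα : α ≠ 0 := by rintro rfl; simp at h1; exact hb h1
    have hβ : β ≠ 0 := by rintro rfl; simp at h1; exact hb h1
    have hγ : γ ≠ 0 := by rintro rfl; simp at h1; exact hb h1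
    have hδ : δ ≠ 0 := by rintro rfl; simp at h1; exact hb h1
    have h6 : s = γ * δ := by
      apply mul_left_cancel₀ (mul_ne_zero hα hβ)
      linarith
    subst h6
    have hαδ : IsCoprime α δ :=
      (hrs.of_isCoprime_of_dvd_left ⟨2 * β, by ring⟩).of_isCoprime_of_dvd_right ⟨γ, by ring⟩
    have hβγ : IsCoprime β γ :=
      ((hmk.of_isCoprime_of_dvd_left ⟨α, by ring⟩).of_isCoprime_of_dvd_right ⟨δ, by ring⟩).symm
    have h7 : α ^ 2 * (4 * β ^ 2 - γ ^ 2) = δ ^ 2 * (β ^ 2 - γ ^ 2) := by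
      linear_combination h3 - h4
    obtain ⟨c, hc⟩ : α ^ 2 ∣ β ^ 2 - γ ^ 2 :=
      (hαδ.pow (m := 2) (n := 2)).dvd_of_dvd_mul_left (Dvd.intro _ h7)
    have hc' : 4 * β ^ 2 - γ ^ 2 = c * δ ^ 2 := by
      apply mul_left_cancel₀ (pow_ne_zero 2 hα)
      rw [h7, hc]; ring
    have hc3 : c ∣ 3 := by
      obtain ⟨u, v, huv⟩ := hβγ.pow (m := 2) (n := 2)
      refine ⟨u * (δ ^ 2 - α ^ 2) - v * (4 * α ^ 2 - δ ^ 2), ?_⟩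
      linear_combination -3 * huv + u * (hc' - hc) - v * (4 * hc - hc')
    have hγ2 : γ ^ 2 % 4 = 1 := sq_odd' γ (by
      rcases Int.emod_two_eq_zero_or_one γ with h | h
      · simp [Int.mul_emod, h] at hs
      · exact h)
    have hδ2 : δ ^ 2 % 4 = 1 := sq_odd' δ (by
      rcases Int.emod_two_eq_zero_or_one δ with h | h
      · simp [Int.mul_emod, h] at hs
      · exact h)
    have hα1 : 1 ≤ α.natAbs := Int.natAbs_pos.2 hα
    have hβ1 : 1 ≤ β.natAbs := Int.natAbs_pos.2 hβ
    have hγ1 : 1 ≤ γ.natAbs := Int.natAbs_pos.2 hγ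
    have hδ1 : 1 ≤ δ.natAbs := Int.natAbs_pos.2 hδ
    have hn' : n = 2 * (α.natAbs * β.natAbs * (γ.natAbs * δ.natAbs)) := by
      rw [← hn, h2]; simp [Int.natAbs_mul]; ring
    have hγδ : 1 ≤ γ.natAbs * δ.natAbs := Nat.mul_pos hγ1 hδ1
    have hαβ : 1 ≤ α.natAbs * β.natAbs := Nat.mul_pos hα1 hβ1
    have hle := Nat.le_mul_of_pos_right (α.natAbs * β.natAbs) hγδ
    have hlα := Nat.le_mul_of_pos_right α.natAbs hβ1
    have hlβ := Nat.le_mul_of_pos_left β.natAbs hα1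
    have hcases : c = 1 ∨ c = -1 ∨ c = 3 ∨ c = -3 := by
      have h9 : c.natAbs ∣ 3 := Int.natAbs_dvd_natAbs.2 hc3
      rcases (Nat.dvd_prime Nat.prime_three).1 h9 with h | h <;> omega
    rcases hcases with rfl | rfl | rfl | rfl
    · omega
    · exact hβ (ih β.natAbs (by omega) hβγ.symm (e := α) (f := δ) (by linarith) (by linarith) rfl)
    · exact hα (ih α.natAbs (by omega) hαδ.symm (e := β) (f := γ) (by linarith) (by linarith) rfl)
    · omega
  have heb : IsCoprime e b := by
    rw [← IsCoprime.pow_left_iff (m := 2) (by norm_num), ← he]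
    rw [show a ^ 2 - b ^ 2 = a ^ 2 + b * -b by ring]
    exact hab.pow_left.add_mul_left_left _
  have hfb : IsCoprime f (2 * b) := by
    refine IsCoprime.mul_right ?_ ?_
    · exact (Int.isCoprime_two_left.2 (Int.odd_iff.2 hff)).symm
    · rw [← IsCoprime.pow_left_iff (m := 2) (by norm_num), ← hf]
      rw [show a ^ 2 - 4 * b ^ 2 = a ^ 2 + b * -(4 * b) by ring]
      exact hab.pow_left.add_mul_left_left _
  obtain ⟨m, k, -, h1, h2, h3, -, -⟩ := PythagoreanTriple.coprime_classification'
    (x := e) (y := b) (z := a) (by unfold PythagoreanTriple; linarith)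
    (Int.isCoprime_iff_gcd_eq_one.1 heb) hee ha
  obtain ⟨r, s, -, h4, h5, h6, h7, -⟩ := PythagoreanTriple.coprime_classification'
    (x := f) (y := 2 * b) (z := a) (by unfold PythagoreanTriple; linarith)
    (Int.isCoprime_iff_gcd_eq_one.1 hfb) hff ha
  rw [← Int.isCoprime_iff_gcd_eq_one] at h3 h6
  rcases h7 with h | h
  · exact key m k r s h3 h6 h.1 h1 (by linarith) h2 h5
  · exact key m k s r h3 h6.symm h.2 h1 (by linarith) h2 (by linarith)

lemma not_isSquare_three {p : ℕ} [Fact p.Prime] (hmod : p % 24 = 17) :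
    ¬ IsSquare (3 : ZMod p) := by
  have h4 : ∀ k : ZMod 3, (2 : ZMod 3) ≠ k * k := by decide
  have : Fact (Nat.Prime 3) := ⟨Nat.prime_three⟩
  have h := ZMod.exists_sq_eq_prime_iff_of_mod_four_eq_one (p := p) (q := 3) (by omega)
    (by norm_num)
  have h2 : ((p : ℕ) : ZMod 3) = ((2 : ℕ) : ZMod 3) :=
    (ZMod.natCast_eq_natCast_iff' _ _ _).2 (by omega)
  rw [h2] at h
  intro h3
  obtain ⟨k, hk⟩ := h.1 (by exact_mod_cast h3)
  exact h4 k (by simpa using hk)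

lemma dvd_of_dvd_sq_sub_three_mul {p : ℕ} (hp : p.Prime) (hmod : p % 24 = 17) {t A B : ℤ}
    (ht : IsSquare (t : ZMod p)) (h : (p : ℤ) ∣ A ^ 2 - 3 * t * B ^ 2) : (p : ℤ) ∣ A := by
  have : Fact p.Prime := ⟨hp⟩
  by_contra hA
  rw [← ZMod.intCast_zmod_eq_zero_iff_dvd] at hA
  rw [← ZMod.intCast_zmod_eq_zero_iff_dvd] at h
  push_cast at h
  obtain ⟨r, hr⟩ := ht
  have h' : (A : ZMod p) ^ 2 = 3 * (r * B) ^ 2 := by rw [hr] at h; linear_combination h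
  have hrB : (r * B : ZMod p) ≠ 0 := by
    intro h0
    rw [h0] at h'
    simp at h'
    exact hA h'
  refine not_isSquare_three hmod ⟨A / (r * B), ?_⟩
  rw [div_mul_div_comm, eq_div_iff (mul_ne_zero hrB hrB)]
  linear_combination -h'

lemma isSquare_two_zmod {p : ℕ} [Fact p.Prime] (hmod : p % 24 = 17) : IsSquare (2 : ZMod p) :=
  (ZMod.exists_sq_eq_two_iff (by omega)).2 (by omega)

lemma isSquare_neg_one_zmod {p : ℕ} [Fact p.Prime] (hmod : p % 24 = 17) :
    IsSquare (-1 : ZMod p) :=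
  ZMod.exists_sq_eq_neg_one_iff.2 (by omega)

lemma Squarefree.dvd_of_sq_dvd_mul_sq {c d z : ℤ} (hc : Squarefree c) (hd : d ≠ 0)
    (h : d ^ 2 ∣ c * z ^ 2) : d ∣ z := by
  have hg : 0 < Int.gcd d z := Int.gcd_pos_of_ne_zero_left z hd
  obtain ⟨d', z', hco, hd', hz'⟩ := Int.exists_gcd_one hg
  have hg0 : (Int.gcd d z : ℤ) ≠ 0 := by exact_mod_cast hg.ne'
  generalize (Int.gcd d z : ℤ) = g at hd' hz' hg0
  subst hd' hz'
  have h1 : d' ^ 2 ∣ c * z' ^ 2 := by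
    rw [← mul_dvd_mul_iff_right (pow_ne_zero 2 hg0), mul_assoc, ← mul_pow, ← mul_pow]
    exact h
  have h2 : d' * d' ∣ c := by
    rw [← pow_two]
    exact ((Int.isCoprime_iff_gcd_eq_one.2 hco).pow (m := 2) (n := 2)).dvd_of_dvd_mul_right h1
  exact mul_dvd_mul_right ((hc d' h2).dvd) g

lemma expo_three_or_three_mul {p : ℕ} (hp : p.Prime) (hp3 : p ≠ 3) {c : ℤ}
    (hc : c = 3 ∨ c = 3 * p) {q : ℕ} (hq : q.Prime) :
    expo q c = if q = 3 then 1 else if q = p ∧ c = 3 * p then 1 else 0 := by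
  have e3 : expo q 3 = if 3 = q then 1 else 0 := expo_prime Nat.prime_three
  rcases hc with rfl | rfl
  · have : (3 : ℤ) ≠ 3 * p := by have := hp.two_le; omega
    simp [e3, eq_comm, this]
  · rw [expo_mul q (by norm_num) (Int.natCast_ne_zero.2 hp.ne_zero), e3, expo_prime hp]
    by_cases h3 : q = 3
    · subst h3; simp [hp3]
    · simp [h3, Ne.symm h3, eq_comm]

lemma isCoprime_sub_add {x y : ℤ} (hxy : IsCoprime x y) (hpar : (x + y) % 2 = 1) :
    IsCoprime (x - y) (x + y) := by
  have cym : IsCoprime y (x - y) := by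
    rw [show x - y = x + y * -1 by ring]; exact hxy.symm.add_mul_left_right _
  have h2 : IsCoprime (x - y) 2 :=
    (Int.isCoprime_two_left.2 (Int.odd_iff.2 (by omega))).symm
  rw [show x + y = 2 * y + (x - y) * 1 by ring]
  exact (h2.mul_right cym.symm).add_mul_left_right _

lemma exists_eq_pow_mul_sq_of_pos {p : ℕ} (hp : p.Prime) (h2 : p ≠ 2) (h3 : p ≠ 3) {x : ℤ}
    (hx : 0 < x) (h : ∀ q : ℕ, q.Prime → q ≠ 3 → q ≠ p → expo q x % 2 = 0) :
    ∃ s : ℤ, x = 3 ^ (expo 3 x % 2) * p ^ (expo p x % 2) * s ^ 2 := by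
  obtain ⟨ε, s, hε, hs⟩ := exists_square_class hp h2 h3 hx.ne'
    (fun q hq _ hq3 hqp => h q hq hq3 hqp)
  rw [h 2 Nat.prime_two (by norm_num) h2.symm, pow_zero, one_mul] at hs
  rcases hε with rfl | rfl
  · exact ⟨s, by linarith⟩
  · have : 0 ≤ 3 ^ (expo 3 x % 2) * (p : ℤ) ^ (expo p x % 2) * s ^ 2 := by positivity
    linarith

lemma exists_eq_sq_or_eq_mul_sq_of_not_three_dvd {p : ℕ} (hp : p.Prime) (hmod : p % 24 = 17)
    {x : ℤ} (hx : 0 < x) (h : ∀ q : ℕ, q.Prime → q ≠ 3 → q ≠ p → expo q x % 2 = 0)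
    (h3 : x % 3 ≠ 0) :
    ∃ s : ℤ, expo p x % 2 = 0 ∧ x = s ^ 2 ∧ x % 3 = 1 ∨
      expo p x % 2 = 1 ∧ x = p * s ^ 2 ∧ x % 3 = 2 := by
  obtain ⟨s, hs⟩ := exists_eq_pow_mul_sq_of_pos hp (by omega) (by omega) hx h
  rw [expo_eq_zero (q := 3) (by norm_num; omega), pow_zero, one_mul] at hs
  have hs3 : s ^ 2 % 3 = 0 ∨ s ^ 2 % 3 = 1 := by
    have : s % 3 = 0 ∨ s % 3 = 1 ∨ s % 3 = 2 := by omega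
    rcases this with h | h | h <;> simp [pow_two, Int.mul_emod, h]
  refine ⟨s, ?_⟩
  rcases Nat.mod_two_eq_zero_or_one (expo p x) with hpx | hpx <;> rw [hpx] at hs
  · rw [pow_zero, one_mul] at hs
    exact Or.inl ⟨hpx, hs, by omega⟩
  · rw [pow_one] at hs
    refine Or.inr ⟨hpx, hs, ?_⟩
    have hp3 : (p : ℤ) % 3 = 2 := by omega
    rw [hs, Int.mul_emod, hp3] at h3 ⊢
    omega

/-- A coprime solution of `x * y * (x - y) * (x + y) = c * z ^ 2` with `c = 3` or `c = 3 * p`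
consists, up to the factor `c` in `y`, of squares. -/
lemma exists_eq_sq_of_mul_sub_mul_add_eq {p : ℕ} (hp : p.Prime) (hmod : p % 24 = 17) {c : ℤ}
    (hc : c = 3 ∨ c = 3 * p) {x y z : ℤ} (hz : z ≠ 0) (hy : 0 < y) (hyx : y < x)
    (hxy : IsCoprime x y) (hpar : (x + y) % 2 = 1)
    (h : x * y * (x - y) * (x + y) = c * z ^ 2) :
    ∃ A B C D : ℤ, x = A ^ 2 ∧ y = c * B ^ 2 ∧ x - y = C ^ 2 ∧ x + y = D ^ 2 := by
  have hpF : Fact p.Prime := ⟨hp⟩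
  have hp2 : p ≠ 2 := by omega
  have hp3 : p ≠ 3 := by omega
  have hpI : Prime (p : ℤ) := Nat.prime_iff_prime_int.1 hp
  have hc0 : c ≠ 0 := by
    have := hp.pos
    rcases hc with rfl | rfl <;> positivity
  have hx0 : 0 < x := by omega
  have hm0 : 0 < x - y := by omega
  have hs0 : 0 < x + y := by omega
  have hxyp : (p : ℤ) ∣ x → (p : ℤ) ∣ y → False := fun h1 h2 =>
    hpI.not_isUnit (hxy.isUnit_of_dvd' h1 h2)
  have htwo : IsSquare ((2 : ℤ) : ZMod p) := by exact_mod_cast isSquare_two_zmod hmod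
  have hexp : ∀ q : ℕ, q.Prime →
      (expo q x + expo q y + expo q (x - y) + expo q (x + y)) % 2 = expo q c % 2 ∧
      expo q x % 2 + expo q y % 2 + expo q (x - y) % 2 + expo q (x + y) % 2 ≤ 1 := by
    intro q hq
    have cxm : IsCoprime x (x - y) := by
      rw [show x - y = -y + x * 1 by ring]; exact hxy.neg_right.add_mul_left_right _
    have cxs : IsCoprime x (x + y) := by
      rw [show x + y = y + x * 1 by ring]; exact hxy.add_mul_left_right _
    have cym : IsCoprime y (x - y) := by
      rw [show x - y = x + y * -1 by ring]; exact hxy.symm.add_mul_left_right _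
    have cys : IsCoprime y (x + y) := by
      rw [show x + y = x + y * 1 by ring]; exact hxy.symm.add_mul_left_right _
    have h1 := congrArg (expo q) h
    rw [expo_mul q (by positivity) hs0.ne', expo_mul q (by positivity) hm0.ne',
      expo_mul q hx0.ne' hy.ne', expo_mul q hc0 (pow_ne_zero 2 hz), expo_sq] at h1
    have h2 := expo_eq_zero_or_of_isCoprime hq hxy
    have h3 := expo_eq_zero_or_of_isCoprime hq cxm
    have h4 := expo_eq_zero_or_of_isCoprime hq cxs
    have h5 := expo_eq_zero_or_of_isCoprime hq cym
    have h6 := expo_eq_zero_or_of_isCoprime hq cys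
    have h7 := expo_eq_zero_or_of_isCoprime hq (isCoprime_sub_add hxy hpar)
    omega
  have heven : ∀ q : ℕ, q.Prime → q ≠ 3 → q ≠ p → expo q x % 2 = 0 ∧ expo q y % 2 = 0 ∧
      expo q (x - y) % 2 = 0 ∧ expo q (x + y) % 2 = 0 := by
    intro q hq q3 qp
    have h1 := hexp q hq
    have h2 := expo_three_or_three_mul hp hp3 hc hq
    simp only [q3, qp, if_false, false_and] at h2
    omega
  have hx' := fun q h1 h2 h3 => (heven q h1 h2 h3).1
  have hy' := fun q h1 h2 h3 => (heven q h1 h2 h3).2.1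
  have hm' := fun q h1 h2 h3 => (heven q h1 h2 h3).2.2.1
  have hs' := fun q h1 h2 h3 => (heven q h1 h2 h3).2.2.2
  have hslot : x % 3 = 0 ∧ expo 3 x % 2 = 1 ∨ y % 3 = 0 ∧ expo 3 y % 2 = 1 ∨
      (x - y) % 3 = 0 ∧ expo 3 (x - y) % 2 = 1 ∨ (x + y) % 3 = 0 ∧ expo 3 (x + y) % 2 = 1 := by
    have hdvd : ∀ F : ℤ, expo 3 F % 2 = 1 → F % 3 = 0 := by
      intro F hF
      by_contra h3
      rw [expo_eq_zero (by norm_num; omega)] at hF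
      omega
    have h1 := hexp 3 Nat.prime_three
    have h2 := expo_three_or_three_mul hp hp3 hc Nat.prime_three
    rw [if_pos rfl] at h2
    have h3 : expo 3 x % 2 = 1 ∨ expo 3 y % 2 = 1 ∨ expo 3 (x - y) % 2 = 1 ∨
      expo 3 (x + y) % 2 = 1 := by omega
    exact h3.imp (fun h => ⟨hdvd _ h, h⟩) (Or.imp (fun h => ⟨hdvd _ h, h⟩)
      (Or.imp (fun h => ⟨hdvd _ h, h⟩) fun h => ⟨hdvd _ h, h⟩))
  have hxy3 : ¬ (x % 3 = 0 ∧ y % 3 = 0) := fun h =>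
    Int.prime_three.not_isUnit (hxy.isUnit_of_dvd' (Int.dvd_of_emod_eq_zero h.1)
      (Int.dvd_of_emod_eq_zero h.2))
  obtain ⟨hpar, hle⟩ := hexp p hp
  have hnot3 := fun {F : ℤ} => exists_eq_sq_or_eq_mul_sq_of_not_three_dvd hp hmod (x := F)
  have hthree := fun {F : ℤ} => exists_eq_pow_mul_sq_of_pos hp hp2 hp3 (x := F)
  clear heven hexp h hz
  rcases hslot with ⟨h3, ho⟩ | ⟨h3, ho⟩ | ⟨h3, ho⟩ | ⟨h3, ho⟩
  · obtain ⟨B, hB⟩ := hnot3 hy hy' (by omega)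
    obtain ⟨C, hC⟩ := hnot3 hm0 hm' (by omega)
    obtain ⟨D, hD⟩ := hnot3 hs0 hs' (by omega)
    obtain ⟨hyB, hmC, px⟩ : y = B ^ 2 ∧ x - y = p * C ^ 2 ∧ expo p x % 2 = 0 := by omega
    obtain ⟨A, hA⟩ := hthree hx0 hx'
    rw [ho, px, pow_zero, pow_one, mul_one] at hA
    have hpB : (p : ℤ) ∣ B := dvd_of_dvd_sq_sub_three_mul hp hmod (t := 1) (B := A) (by simp)
      ⟨-C ^ 2, by linear_combination -hmC + hA - hyB⟩
    have hpy : (p : ℤ) ∣ y := hyB ▸ dvd_pow hpB two_ne_zero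
    exact (hxyp ((dvd_sub_left hpy).1 ⟨_, hmC⟩) hpy).elim
  · obtain ⟨A, hA⟩ := hnot3 hx0 hx' (by omega)
    obtain ⟨C, hC⟩ := hnot3 hm0 hm' (by omega)
    obtain ⟨D, hD⟩ := hnot3 hs0 hs' (by omega)
    obtain ⟨hxA, hmC, hsD, py⟩ : x = A ^ 2 ∧ x - y = C ^ 2 ∧ x + y = D ^ 2 ∧
      expo p y % 2 = expo p c % 2 := by omega
    obtain ⟨B, hB⟩ := hthree hy hy'
    refine ⟨A, B, C, D, hxA, ?_, hmC, hsD⟩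
    have hcp := expo_three_or_three_mul hp hp3 hc hp
    rw [ho, py, hcp, if_neg hp3] at hB
    rcases hc with hc | hc
    · have hc' : c ≠ 3 * p := by have := hp.two_le; omega
      rw [if_neg fun h => hc' h.2] at hB
      simpa [hc] using hB
    · simpa [hc] using hB
  · obtain ⟨A, hA⟩ := hnot3 hx0 hx' (by omega)
    obtain ⟨B, hB⟩ := hnot3 hy hy' (by omega)
    obtain ⟨D, hD⟩ := hnot3 hs0 hs' (by omega)
    obtain ⟨hxA, hsD, pm⟩ : x = A ^ 2 ∧ x + y = p * D ^ 2 ∧ expo p (x - y) % 2 = 0 := by omega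
    obtain ⟨C, hC⟩ := hthree hm0 hm'
    rw [ho, pm, pow_zero, pow_one, mul_one] at hC
    have hp2A : (p : ℤ) ∣ 2 * A := dvd_of_dvd_sq_sub_three_mul hp hmod (B := C) htwo
      ⟨2 * D ^ 2, by linear_combination 2 * hsD + 2 * hC - 4 * hxA⟩
    have hpA : (p : ℤ) ∣ A := (hpI.dvd_or_dvd hp2A).resolve_left fun h => by
      have := Int.le_of_dvd (by norm_num) h
      have := hp.two_le
      omega
    have hpx : (p : ℤ) ∣ x := hxA ▸ dvd_pow hpA two_ne_zero
    exact (hxyp hpx ((dvd_add_right hpx).1 ⟨_, hsD⟩)).elim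
  · obtain ⟨A, hA⟩ := hnot3 hx0 hx' (by omega)
    obtain ⟨B, hB⟩ := hnot3 hy hy' (by omega)
    obtain ⟨C, hC⟩ := hnot3 hm0 hm' (by omega)
    obtain ⟨hxA, hyB, ps⟩ : x = p * A ^ 2 ∧ y = B ^ 2 ∧ expo p (x + y) % 2 = 0 := by omega
    obtain ⟨D, hD⟩ := hthree hs0 hs'
    rw [ho, ps, pow_zero, pow_one, mul_one] at hD
    have hpB : (p : ℤ) ∣ B := dvd_of_dvd_sq_sub_three_mul hp hmod (t := 1) (B := D) (by simp)
      ⟨-A ^ 2, by linear_combination hD - hyB - hxA⟩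
    exact (hxyp ⟨_, hxA⟩ (hyB ▸ dvd_pow hpB two_ne_zero)).elim

lemma even_of_four_mul_eq_mul_sq {c t k : ℤ} (hc : c % 2 = 1) (h : 4 * t = c * k ^ 2) :
    k % 2 = 0 := by
  by_contra hk
  have hk1 : k % 2 = 1 := by omega
  have : (c * k ^ 2) % 2 = 1 := by simp [pow_two, Int.mul_emod, hc, hk1]
  omega

lemma exists_smaller_mul_sub_mul_add_eq {c A B C D : ℤ} (hc : c % 2 = 1) (hB0 : c * B ^ 2 ≠ 0)
    (hpar : (A ^ 2 + c * B ^ 2) % 2 = 1) (hAB : IsCoprime (A ^ 2) (c * B ^ 2))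
    (hm : A ^ 2 - c * B ^ 2 = C ^ 2) (hs : A ^ 2 + c * B ^ 2 = D ^ 2) :
    ∃ r s B' : ℤ, B' ≠ 0 ∧ B = 2 * B' ∧ r * s * (r - s) * (r + s) = c * B' ^ 2 := by
  have cms : IsCoprime (A ^ 2 - c * B ^ 2) (A ^ 2 + c * B ^ 2) :=
    isCoprime_sub_add hAB hpar
  have hCD : IsCoprime C D := by
    rw [hm, hs] at cms
    exact (IsCoprime.pow_iff (by norm_num) (by norm_num)).1 cms
  have sq_odd : ∀ t : ℤ, t ^ 2 % 2 = 1 → t % 2 = 1 := by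
    intro t ht
    rcases Int.emod_two_eq_zero_or_one t with h | h
    · simp [pow_two, Int.mul_emod, h] at ht
    · exact h
  have hCo := sq_odd C (by omega)
  have hDo := sq_odd D (by omega)
  obtain ⟨X, Y, rfl, rfl⟩ : ∃ X Y, D = X + Y ∧ C = X - Y :=
    ⟨(D + C) / 2, (D - C) / 2, by omega, by omega⟩
  have hXY : IsCoprime X Y := by
    obtain ⟨u, v, huv⟩ := hCD
    exact ⟨u + v, v - u, by linear_combination huv⟩
  have hyB : 2 * (X * Y) = c * B ^ 2 := by linarith
  have htriple : PythagoreanTriple X Y A := by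
    unfold PythagoreanTriple
    linarith
  obtain ⟨r, s, hrs, -⟩ := PythagoreanTriple.coprime_classification.1
    ⟨htriple, Int.isCoprime_iff_gcd_eq_one.1 hXY⟩
  have h4 : 4 * (r * s * (r - s) * (r + s)) = c * B ^ 2 := by
    rw [← hyB]
    rcases hrs with ⟨rfl, rfl⟩ | ⟨rfl, rfl⟩ <;> ring
  obtain ⟨B', rfl⟩ : (2 : ℤ) ∣ B := Int.dvd_of_emod_eq_zero (even_of_four_mul_eq_mul_sq hc h4)
  exact ⟨r, s, B', by rintro rfl; simp at hB0, rfl, by linarith⟩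

/-- Neither `3` nor `3 * p` is a congruent number. -/
theorem mul_sub_mul_add_ne_mul_sq {p : ℕ} (hp : p.Prime) (hmod : p % 24 = 17) {c : ℤ}
    (hc : c = 3 ∨ c = 3 * p) {x y z : ℤ} (hz : z ≠ 0) :
    x * y * (x - y) * (x + y) ≠ c * z ^ 2 := by
  have hp3 : p ≠ 3 := by rintro rfl; omega
  have hc0 : 0 < c := by
    have := hp.pos
    rcases hc with rfl | rfl <;> positivity
  have hc2 : c % 2 = 1 := by rcases hc with rfl | rfl <;> omega
  have hcsf : Squarefree c := by
    rcases hc with rfl | rfl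
    · exact Int.prime_three.squarefree
    · have : Squarefree (3 * p) := (Nat.squarefree_mul
        ((Nat.coprime_primes Nat.prime_three hp).2 hp3.symm)).2
        ⟨Nat.prime_three.squarefree, hp.prime.squarefree⟩
      exact_mod_cast Int.squarefree_natCast.2 this
  induction hn : z.natAbs using Nat.strong_induction_on generalizing x y z with
  | _ n ih =>
  have pos : ∀ x y : ℤ, 0 < y → y < x → x * y * (x - y) * (x + y) = c * z ^ 2 → False := by
    intro x y hy hyx h
    have hxy : IsCoprime x y := by
      have hg : 0 < Int.gcd x y := Int.gcd_pos_of_ne_zero_left y (by omega)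
      obtain ⟨x', y', hco, hx', hy'⟩ := Int.exists_gcd_one hg
      rw [Int.isCoprime_iff_gcd_eq_one]
      by_contra hg1
      have hg2 : 2 ≤ Int.gcd x y := by omega
      generalize Int.gcd x y = g at hx' hy' hg2
      have hg0 : (g : ℤ) ≠ 0 := by omega
      have hdvd : (g : ℤ) ^ 2 ∣ z := hcsf.dvd_of_sq_dvd_mul_sq (pow_ne_zero 2 hg0)
        ⟨x' * y' * (x' - y') * (x' + y'), by rw [← h, hx', hy']; ring⟩
      obtain ⟨z', rfl⟩ := hdvd
      have hz' : z' ≠ 0 := right_ne_zero_of_mul hz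
      refine ih z'.natAbs ?_ (x := x') (y := y') hz' rfl ?_
      · rw [← hn, Int.natAbs_mul, Int.natAbs_pow, Int.natAbs_natCast]
        exact lt_mul_of_one_lt_left (Int.natAbs_pos.2 hz') (Nat.one_lt_pow two_ne_zero hg2)
      · apply mul_left_cancel₀ (pow_ne_zero 4 hg0)
        rw [hx', hy'] at h
        linear_combination h
    have hpar : (x + y) % 2 = 1 := by
      have h2 : ¬ (x % 2 = 0 ∧ y % 2 = 0) := fun h =>
        Int.prime_two.not_isUnit (hxy.isUnit_of_dvd' (Int.dvd_of_emod_eq_zero h.1)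
          (Int.dvd_of_emod_eq_zero h.2))
      by_contra hpar
      obtain ⟨u, w, rfl, rfl⟩ : ∃ u w, x = u + w ∧ y = u - w :=
        ⟨(x + y) / 2, (x - y) / 2, by omega, by omega⟩
      obtain ⟨z', rfl⟩ : (2 : ℤ) ∣ z := Int.dvd_of_emod_eq_zero
        (even_of_four_mul_eq_mul_sq hc2 (t := u * w * (u - w) * (u + w)) (by linear_combination h))
      have hz' : z' ≠ 0 := right_ne_zero_of_mul hz
      exact ih z'.natAbs (by omega) (x := u) (y := w) hz' rfl (by linarith)
    obtain ⟨A, B, C, D, rfl, rfl, hm, hs⟩ :=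
      exists_eq_sq_of_mul_sub_mul_add_eq hp hmod hc hz hy hyx hxy hpar h
    obtain ⟨r, s, B', hB', rfl, hrs⟩ :=
      exists_smaller_mul_sub_mul_add_eq hc2 hy.ne' hpar hxy hm hs
    have hzB : 2 * B' ∣ z := by
      rw [← Int.pow_dvd_pow_iff (n := 2) two_ne_zero]
      refine ⟨A ^ 2 * C ^ 2 * D ^ 2, mul_left_cancel₀ hc0.ne' ?_⟩
      rw [← h, hm, hs]
      ring
    obtain ⟨w, rfl⟩ := hzB
    refine ih B'.natAbs ?_ (x := r) (y := s) hB' rfl hrs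
    have h5 := Int.natAbs_pos.2 hB'
    have h6 := Int.natAbs_pos.2 (right_ne_zero_of_mul hz)
    have h7 := Nat.le_mul_of_pos_right B'.natAbs h6
    rw [← hn, Int.natAbs_mul, Int.natAbs_mul, mul_assoc]
    simp only [Int.reduceAbs]
    omega
  intro h
  have hpos : 0 < x * y * (x ^ 2 - y ^ 2) := by
    have : 0 < c * z ^ 2 := by positivity
    linarith
  have hx0 : x ≠ 0 := by rintro rfl; simp at hpos
  have hy0 : y ≠ 0 := by rintro rfl; simp at hpos
  rcases lt_trichotomy |y| |x| with hlt | heq | hlt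
  · have h1 : 0 < x ^ 2 - y ^ 2 := sub_pos.2 (sq_lt_sq.2 hlt)
    have h2 : |x| * |y| = x * y := by
      rw [← abs_mul, abs_of_pos (pos_of_mul_pos_left hpos h1.le)]
    refine pos |x| |y| (abs_pos.2 hy0) hlt ?_
    rw [h2, ← h]
    linear_combination x * y * (sq_abs x - sq_abs y)
  · rw [(sq_eq_sq_iff_abs_eq_abs x y).2 heq.symm] at hpos
    simp at hpos
  · have h1 : x ^ 2 - y ^ 2 < 0 := sub_neg.2 (sq_lt_sq.2 hlt)
    have h2 : |y| * |x| = -(x * y) := by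
      rw [← abs_mul, mul_comm, abs_of_neg (neg_of_mul_pos_left hpos h1.le)]
    refine pos |y| |x| (abs_pos.2 hx0) hlt ?_
    rw [h2, ← h]
    linear_combination x * y * (sq_abs x - sq_abs y)

lemma expo_neg (q : ℕ) (x : ℤ) : expo q (-x) = expo q x := by simp [expo]

lemma expo_mul_four (q : ℕ) {x y u v : ℤ} (hx : x ≠ 0) (hy : y ≠ 0) (hu : u ≠ 0) (hv : v ≠ 0) :
    expo q (x * y * u * v) = expo q x + expo q y + expo q u + expo q v := by
  rw [expo_mul q (mul_ne_zero (mul_ne_zero hx hy) hu) hv, expo_mul q (mul_ne_zero hx hy) hu,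
    expo_mul q hx hy]

/-- The square class of `x * y * (x - y) * (x + y)` is neither `± 3` nor `± 3 * p`. -/
lemma false_of_expo_mul_sub_mul_add {p : ℕ} (hp : p.Prime) (hmod : p % 24 = 17) {x y u v : ℤ}
    (hu : u = x - y) (hv : v = x + y) (hx0 : x ≠ 0) (hy0 : y ≠ 0) (hu0 : u ≠ 0) (hv0 : v ≠ 0)
    (h : ∀ q : ℕ, q.Prime → q ≠ 2 → q ≠ 3 → q ≠ p →
      (expo q x + expo q y + expo q u + expo q v) % 2 = 0)
    (h2 : (expo 2 x + expo 2 y + expo 2 u + expo 2 v) % 2 = 0)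
    (h3 : (expo 3 x + expo 3 y + expo 3 u + expo 3 v) % 2 = 1) : False := by
  have hM : x * y * u * v ≠ 0 := mul_ne_zero (mul_ne_zero (mul_ne_zero hx0 hy0) hu0) hv0
  have hexp := fun q => expo_mul_four q hx0 hy0 hu0 hv0
  obtain ⟨ε, s, hε, hs⟩ := exists_square_class hp (by omega) (by omega) hM
    (fun q h1 h2 h3 h4 => by rw [hexp]; exact h q h1 h2 h3 h4)
  rw [hexp 2, h2, hexp 3, h3, pow_zero, pow_one, one_mul] at hs
  have hs0 : s ≠ 0 := by
    rintro rfl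
    exact hM (by rw [hs]; ring)
  obtain ⟨c, hc, hcs⟩ : ∃ c : ℤ, (c = 3 ∨ c = 3 * p) ∧ x * y * u * v = ε * (c * s ^ 2) := by
    rcases Nat.mod_two_eq_zero_or_one (expo p (x * y * u * v)) with hp' | hp' <;> rw [hp'] at hs
    · exact ⟨3, Or.inl rfl, by rw [hs]; ring⟩
    · exact ⟨3 * p, Or.inr rfl, by rw [hs]; ring⟩
  subst hu hv
  rcases hε with rfl | rfl
  · exact mul_sub_mul_add_ne_mul_sq hp hmod hc hs0 (x := x) (y := y) (by linarith)
  · exact mul_sub_mul_add_ne_mul_sq hp hmod hc hs0 (x := y) (y := x) (by linarith)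

lemma exists_eq_two_pow_mul_pow_mul_sq {p : ℕ} (hp : p.Prime) (h2 : p ≠ 2) (h3 : p ≠ 3) {x : ℤ}
    (hx : x ≠ 0) (h : ∀ q : ℕ, q.Prime → q ≠ 2 → q ≠ p → expo q x % 2 = 0) :
    ∃ ε s : ℤ, (ε = 1 ∨ ε = -1) ∧ x = ε * (2 ^ (expo 2 x % 2) * p ^ (expo p x % 2)) * s ^ 2 := by
  obtain ⟨ε, s, hε, hs⟩ := exists_square_class hp h2 h3 hx
    (fun q hq hq2 _ hqp => h q hq hq2 hqp)
  rw [h 3 Nat.prime_three (by norm_num) h3.symm, pow_zero, mul_one] at hs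
  exact ⟨ε, s, hε, hs⟩

lemma isSquare_zmod_of_expo {p : ℕ} (hp : p.Prime) (hmod : p % 24 = 17) {x : ℤ}
    (hx : x ≠ 0) (h : ∀ q : ℕ, q.Prime → q ≠ 2 → expo q x % 2 = 0) :
    IsSquare (x : ZMod p) := by
  have : Fact p.Prime := ⟨hp⟩
  obtain ⟨ε, s, hε, hs⟩ := exists_eq_two_pow_mul_pow_mul_sq hp (by omega) (by omega) hx
    fun q hq hq2 _ => h q hq hq2
  rw [h p hp (by omega), pow_zero, mul_one] at hs
  rw [hs]
  push_cast
  refine (IsSquare.mul ?_ ((isSquare_two_zmod hmod).pow _)).mul (IsSquare.sq _)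
  rcases hε with rfl | rfl
  · simp
  · simpa using isSquare_neg_one_zmod hmod

lemma dvd_of_isSquare_of_dvd_three_mul {p : ℕ} (hp : p.Prime) (hmod : p % 24 = 17) {x y : ℤ}
    (hx : IsSquare (x : ZMod p)) (hy : IsSquare (y : ZMod p))
    (h : (p : ℤ) ∣ y - 3 * x ∨ (p : ℤ) ∣ y + 3 * x) : (p : ℤ) ∣ x := by
  have : Fact p.Prime := ⟨hp⟩
  wlog h' : (p : ℤ) ∣ y - 3 * x generalizing y
  · refine this (y := -y) ?_ ?_ ?_
    · push_cast
      rw [neg_eq_neg_one_mul]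
      exact (isSquare_neg_one_zmod hmod).mul hy
    · left
      rw [show -y - 3 * x = -(y + 3 * x) by ring, dvd_neg]
      exact h.resolve_left h'
    · rw [show -y - 3 * x = -(y + 3 * x) by ring, dvd_neg]
      exact h.resolve_left h'
  rw [← ZMod.intCast_zmod_eq_zero_iff_dvd] at h' ⊢
  push_cast at h'
  by_contra hx0
  refine not_isSquare_three hmod ?_
  rw [show (3 : ZMod p) = y / x by rw [eq_div_iff hx0]; linear_combination -h']
  exact hy.div hx

/-- An odd number whose exponents away from `p` are even is `±1` modulo `8`, according to sign. -/
lemma exists_sign_of_odd {p : ℕ} (hp : p.Prime) (hmod : p % 24 = 17) {x : ℤ} (hx : x % 2 = 1)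
    (h : ∀ q : ℕ, q.Prime → q ≠ 2 → q ≠ p → expo q x % 2 = 0) :
    ∃ ε s : ℤ, x = ε * p ^ (expo p x % 2) * s ^ 2 ∧ (ε = 1 ∧ x % 8 = 1 ∨ ε = -1 ∧ x % 8 = 7) := by
  obtain ⟨ε, s, hε, hs⟩ := exists_eq_two_pow_mul_pow_mul_sq hp (by omega) (by omega)
    (by omega : x ≠ 0) h
  rw [expo_eq_zero (q := 2) (by norm_num; omega), pow_zero, one_mul] at hs
  refine ⟨ε, s, hs, ?_⟩
  have hp8 : (p : ℤ) ^ (expo p x % 2) % 8 = 1 := by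
    rcases Nat.mod_two_eq_zero_or_one (expo p x) with h | h <;> rw [h] <;> norm_num
    omega
  have hs8 : s ^ 2 % 8 = 1 := by
    have hs2 : s % 2 = 1 := by
      by_contra hs2
      have hs2 : s % 2 = 0 := by omega
      rw [hs] at hx
      simp [pow_two, Int.mul_emod, hs2] at hx
    have : s % 8 = 1 ∨ s % 8 = 3 ∨ s % 8 = 5 ∨ s % 8 = 7 := by omega
    rcases this with h | h | h | h <;> simp [pow_two, Int.mul_emod, h]
  have hx8 : x % 8 = ε % 8 := by
    rw [hs, Int.mul_emod, hs8, Int.mul_emod ε, hp8]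
    simp
  omega

lemma emod_eight_of_odd {p : ℕ} (hp : p.Prime) (hmod : p % 24 = 17) {x : ℤ} (hx : x % 2 = 1)
    (h : ∀ q : ℕ, q.Prime → q ≠ 2 → q ≠ p → expo q x % 2 = 0) : x % 8 = 1 ∨ x % 8 = 7 := by
  obtain ⟨ε, s, -, h⟩ := exists_sign_of_odd hp hmod hx h
  exact h.imp And.right And.right

lemma exists_mul_eq_sq_of_emod_eight_eq {p : ℕ} (hp : p.Prime) (hmod : p % 24 = 17) {x y : ℤ}
    (hx : x % 2 = 1) (hxy : x % 8 = y % 8)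
    (hex : ∀ q : ℕ, q.Prime → q ≠ 2 → expo q x % 2 = 0)
    (hey : ∀ q : ℕ, q.Prime → q ≠ 2 → expo q y % 2 = 0) : ∃ e : ℤ, x * y = e ^ 2 := by
  obtain ⟨ε, s, hs, h⟩ := exists_sign_of_odd hp hmod hx fun q h1 h2 _ => hex q h1 h2
  obtain ⟨δ, t, ht, h'⟩ := exists_sign_of_odd hp hmod (x := y) (by omega)
    fun q h1 h2 _ => hey q h1 h2
  rw [hex p hp (by omega), pow_zero, mul_one] at hs
  rw [hey p hp (by omega), pow_zero, mul_one] at ht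
  obtain rfl : ε = δ := by omega
  have hε : ε ^ 2 = 1 := by
    rcases h with ⟨h, -⟩ | ⟨h, -⟩ <;> rw [h] <;> norm_num
  exact ⟨s * t, by rw [hs, ht]; linear_combination s ^ 2 * t ^ 2 * hε⟩

lemma four_dvd_of_even_expo {p : ℕ} (hp : p.Prime) (hmod : p % 24 = 17) {x : ℤ} (hx0 : x ≠ 0)
    (hx : x % 2 = 0) (h : ∀ q : ℕ, q.Prime → q ≠ p → expo q x % 2 = 0) : x % 4 = 0 := by
  obtain ⟨ε, s, hε, hs⟩ := exists_eq_two_pow_mul_pow_mul_sq hp (by omega) (by omega) hx0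
    fun q hq _ hqp => h q hq hqp
  rw [h 2 Nat.prime_two (by omega), pow_zero, one_mul] at hs
  have h2 : (2 : ℤ) ∣ s := by
    have hd : (2 : ℤ) ∣ ε * p ^ (expo p x % 2) * s ^ 2 := hs ▸ Int.dvd_of_emod_eq_zero hx
    refine Int.prime_two.dvd_of_dvd_pow ((Int.prime_two.dvd_or_dvd hd).resolve_left fun h' => ?_)
    rcases Int.prime_two.dvd_or_dvd h' with h' | h'
    · omega
    · have := Int.prime_two.dvd_of_dvd_pow h'
      omega
  obtain ⟨t, rfl⟩ := h2
  refine Int.emod_eq_zero_of_dvd ⟨ε * p ^ (expo p x % 2) * t ^ 2, ?_⟩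
  linear_combination hs

lemma expo_eq_zero_or_of_twelve {q : ℕ} (hq : q.Prime) (h2 : q ≠ 2) (h3 : q ≠ 3) {a b x y : ℤ}
    (hab : IsCoprime a b) (α β γ δ : ℤ) (ha : 12 * a = α * x + β * y)
    (hb : 12 * b = γ * x + δ * y) : expo q x = 0 ∨ expo q y = 0 := by
  by_contra! hc
  have hx : (q : ℤ) ∣ x := by_contra fun h' => hc.1 (expo_eq_zero h')
  have hy : (q : ℤ) ∣ y := by_contra fun h' => hc.2 (expo_eq_zero h')
  have hqI : Prime (q : ℤ) := Nat.prime_iff_prime_int.1 hq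
  have h12 : ∀ t : ℤ, (q : ℤ) ∣ 12 * t → (q : ℤ) ∣ t := by
    intro t ht
    refine (hqI.dvd_or_dvd ht).resolve_left fun h => ?_
    have h' : q ∣ 2 * 2 * 3 := by exact_mod_cast h
    rw [hq.dvd_mul, hq.dvd_mul, Nat.prime_dvd_prime_iff_eq hq Nat.prime_two,
      Nat.prime_dvd_prime_iff_eq hq Nat.prime_three] at h'
    omega
  exact hqI.not_isUnit (hab.isUnit_of_dvd'
    (h12 a (ha ▸ dvd_add (hx.mul_left _) (hy.mul_left _)))
    (h12 b (hb ▸ dvd_add (hx.mul_left _) (hy.mul_left _))))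

lemma expo_sum_mod_two_le_one {q : ℕ} (hq : q.Prime) (h2 : q ≠ 2) (h3 : q ≠ 3) {a b : ℤ}
    (hab : IsCoprime a b) :
    expo q b % 2 + expo q a % 2 + expo q (a - b) % 2 + expo q (a + b) % 2 +
      expo q (a - 2 * b) % 2 + expo q (a + 2 * b) % 2 ≤ 1 := by
  have key := fun {x y : ℤ} => expo_eq_zero_or_of_twelve (x := x) (y := y) hq h2 h3 hab
  have h1 : expo q b = 0 ∨ expo q a = 0 := key 0 12 12 0 (by ring) (by ring)
  have h2 : expo q b = 0 ∨ expo q (a - b) = 0 := key 12 12 12 0 (by ring) (by ring)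
  have h3 : expo q b = 0 ∨ expo q (a + b) = 0 := key (-12) 12 12 0 (by ring) (by ring)
  have h4 : expo q b = 0 ∨ expo q (a - 2 * b) = 0 := key 24 12 12 0 (by ring) (by ring)
  have h5 : expo q b = 0 ∨ expo q (a + 2 * b) = 0 := key (-24) 12 12 0 (by ring) (by ring)
  have h6 : expo q a = 0 ∨ expo q (a - b) = 0 := key 12 0 12 (-12) (by ring) (by ring)
  have h7 : expo q a = 0 ∨ expo q (a + b) = 0 := key 12 0 (-12) 12 (by ring) (by ring)
  have h8 : expo q a = 0 ∨ expo q (a - 2 * b) = 0 := key 12 0 6 (-6) (by ring) (by ring)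
  have h9 : expo q a = 0 ∨ expo q (a + 2 * b) = 0 := key 12 0 (-6) 6 (by ring) (by ring)
  have h10 : expo q (a - b) = 0 ∨ expo q (a + b) = 0 := key 6 6 (-6) 6 (by ring) (by ring)
  have h11 : expo q (a - b) = 0 ∨ expo q (a - 2 * b) = 0 :=
    key 24 (-12) 12 (-12) (by ring) (by ring)
  have h12 : expo q (a - b) = 0 ∨ expo q (a + 2 * b) = 0 := key 8 4 (-4) 4 (by ring) (by ring)
  have h13 : expo q (a + b) = 0 ∨ expo q (a - 2 * b) = 0 := key 8 4 4 (-4) (by ring) (by ring)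
  have h14 : expo q (a + b) = 0 ∨ expo q (a + 2 * b) = 0 :=
    key 24 (-12) (-12) 12 (by ring) (by ring)
  have h15 : expo q (a - 2 * b) = 0 ∨ expo q (a + 2 * b) = 0 :=
    key 6 6 (-3) 3 (by ring) (by ring)
  by_cases hb : expo q b = 0
  swap
  · rw [h1.resolve_left hb, h2.resolve_left hb, h3.resolve_left hb, h4.resolve_left hb,
      h5.resolve_left hb]
    clear * -
    omega
  by_cases ha : expo q a = 0
  swap
  · rw [hb, h6.resolve_left ha, h7.resolve_left ha, h8.resolve_left ha, h9.resolve_left ha]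
    clear * -
    omega
  by_cases hm : expo q (a - b) = 0
  swap
  · rw [hb, ha, h10.resolve_left hm, h11.resolve_left hm, h12.resolve_left hm]
    clear * -
    omega
  by_cases ht : expo q (a + b) = 0
  swap
  · rw [hb, ha, hm, h13.resolve_left ht, h14.resolve_left ht]
    clear * -
    omega
  rw [hb, ha, hm, ht]
  clear * - h15
  omega

lemma expo_two_sum_even {a b : ℤ} (hab : IsCoprime a b)
    (h : (0 + (expo 2 b + expo 2 a + expo 2 (a - b) + expo 2 (a + b) +
      expo 2 (a - 2 * b) + expo 2 (a + 2 * b))) % 2 = 0) :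
    (expo 2 a + expo 2 b + expo 2 (a - b) + expo 2 (a + b)) % 2 = 0 ∨
      (expo 2 (a - b) + expo 2 b + expo 2 (a - 2 * b) + expo 2 a) % 2 = 0 ∨
      (expo 2 (a + b) + expo 2 b + expo 2 a + expo 2 (a + 2 * b)) % 2 = 0 := by
  have hz : ∀ x : ℤ, x % 2 = 1 → expo 2 x = 0 := fun x hx => expo_eq_zero (by norm_num; omega)
  have hab2 : ¬ (a % 2 = 0 ∧ b % 2 = 0) := fun h =>
    Int.prime_two.not_isUnit (hab.isUnit_of_dvd' (Int.dvd_of_emod_eq_zero h.1)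
      (Int.dvd_of_emod_eq_zero h.2))
  rcases Int.emod_two_eq_zero_or_one a with ha | ha
  · rw [hz b (by omega), hz (a - b) (by omega), hz (a + b) (by omega)] at *
    omega
  · rw [hz a (by omega), hz (a - 2 * b) (by omega), hz (a + 2 * b) (by omega)] at *
    omega

lemma expo_three_parity {a b : ℤ} (hab : IsCoprime a b)
    (h : (0 + (expo 3 b + expo 3 a + expo 3 (a - b) + expo 3 (a + b) +
      expo 3 (a - 2 * b) + expo 3 (a + 2 * b))) % 2 = 0) :
    (expo 3 b % 2 = 0 ∧ expo 3 a % 2 = 0 ∧ expo 3 (a - b) % 2 = 0 ∧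
      expo 3 (a + b) % 2 = 0 ∧ expo 3 (a - 2 * b) % 2 = 0 ∧ expo 3 (a + 2 * b) % 2 = 0) ∨
      ((expo 3 a + expo 3 b + expo 3 (a - b) + expo 3 (a + b)) % 2 = 1 ∧
      (expo 3 (a - b) + expo 3 b + expo 3 (a - 2 * b) + expo 3 a) % 2 = 1 ∧
      (expo 3 (a + b) + expo 3 b + expo 3 a + expo 3 (a + 2 * b)) % 2 = 1) := by
  have hz : ∀ x : ℤ, x % 3 ≠ 0 → expo 3 x = 0 := fun x hx => expo_eq_zero (by norm_num; omega)
  have hab3 : ¬ (a % 3 = 0 ∧ b % 3 = 0) := fun h =>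
    Int.prime_three.not_isUnit (hab.isUnit_of_dvd' (Int.dvd_of_emod_eq_zero h.1)
      (Int.dvd_of_emod_eq_zero h.2))
  by_cases hb : b % 3 = 0
  · rw [hz a (by omega), hz (a - b) (by omega), hz (a + b) (by omega), hz (a - 2 * b) (by omega),
      hz (a + 2 * b) (by omega)] at *
    omega
  by_cases ha : a % 3 = 0
  · rw [hz b (by omega), hz (a - b) (by omega), hz (a + b) (by omega), hz (a - 2 * b) (by omega),
      hz (a + 2 * b) (by omega)] at *
    omega
  by_cases hm : (a - b) % 3 = 0
  · rw [hz a ha, hz b hb, hz (a + b) (by omega), hz (a - 2 * b) (by omega)] at *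
    omega
  · rw [hz a ha, hz b hb, hz (a - b) hm, hz (a + 2 * b) (by omega)] at *
    omega

/-- Integral form of the absence of rational points with `y ≠ 0` on `C_p`. -/
theorem mul_six_forms_ne_sq {p : ℕ} (hp : p.Prime) (hmod : p % 24 = 17) {a b w : ℤ}
    (hab : IsCoprime a b)
    (h : p * (b * a * (a - b) * (a + b) * (a - 2 * b) * (a + 2 * b)) = w ^ 2) :
    w = 0 := by
  by_contra hw
  have hp0 : (p : ℤ) ≠ 0 := Int.natCast_ne_zero.2 hp.ne_zero
  have hpI : Prime (p : ℤ) := Nat.prime_iff_prime_int.1 hp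
  have hP := pow_ne_zero 2 hw
  rw [← h] at hP
  have h6 := right_ne_zero_of_mul hP
  have hs0 := right_ne_zero_of_mul h6
  have h5 := left_ne_zero_of_mul h6
  have hr0 := right_ne_zero_of_mul h5
  have h4 := left_ne_zero_of_mul h5
  have ht0 := right_ne_zero_of_mul h4
  have h3 := left_ne_zero_of_mul h4
  have hm0 := right_ne_zero_of_mul h3
  have ha0 := right_ne_zero_of_mul (left_ne_zero_of_mul h3)
  have hb0 := left_ne_zero_of_mul (left_ne_zero_of_mul h3)
  have hsum : ∀ q : ℕ, (expo q p + (expo q b + expo q a + expo q (a - b) + expo q (a + b) +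
      expo q (a - 2 * b) + expo q (a + 2 * b))) % 2 = 0 := by
    intro q
    have := congrArg (expo q) h
    rw [expo_mul q hp0 h6, expo_mul q h5 hs0, expo_mul q h4 hr0, expo_mul_four q hb0 ha0 hm0 ht0,
      expo_sq] at this
    omega
  have hab2 : ¬ (a % 2 = 0 ∧ b % 2 = 0) := fun h =>
    Int.prime_two.not_isUnit (hab.isUnit_of_dvd' (Int.dvd_of_emod_eq_zero h.1)
      (Int.dvd_of_emod_eq_zero h.2))
  have habp : (p : ℤ) ∣ a → (p : ℤ) ∣ b → False := fun h1 h2 =>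
    hpI.not_isUnit (hab.isUnit_of_dvd' h1 h2)
  have heven : ∀ q : ℕ, q.Prime → q ≠ 2 → q ≠ 3 → q ≠ p → expo q b % 2 = 0 ∧ expo q a % 2 = 0 ∧
      expo q (a - b) % 2 = 0 ∧ expo q (a + b) % 2 = 0 ∧ expo q (a - 2 * b) % 2 = 0 ∧
      expo q (a + 2 * b) % 2 = 0 := by
    intro q hq q2 q3 qp
    have h1 := hsum q
    have h2 := expo_sum_mod_two_le_one hq q2 q3 hab
    rw [expo_prime hp, if_neg qp.symm] at h1
    omega
  have hz2 : ∀ x : ℤ, x % 2 = 1 → expo 2 x = 0 := fun x hx =>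
    expo_eq_zero (by norm_num; omega)
  have hsum2 := hsum 2
  rw [expo_prime hp, if_neg (by omega)] at hsum2
  have htwo := expo_two_sum_even hab hsum2
  have hsum3 := hsum 3
  rw [expo_prime hp, if_neg (by omega)] at hsum3
  have hthree := expo_three_parity hab hsum3
  rcases hthree with h3' | ⟨o1, o2, o3⟩
  swap
  · have key := fun {x y u v : ℤ} => false_of_expo_mul_sub_mul_add (x := x) (y := y) (u := u)
      (v := v) hp hmod
    rcases htwo with e | e | e
    · exact key rfl rfl ha0 hb0 hm0 ht0
        (fun q h1 h2 h3 h4 => by have := heven q h1 h2 h3 h4; omega) e o1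
    · exact key (by ring) (by ring) hm0 hb0 hr0 ha0
        (fun q h1 h2 h3 h4 => by have := heven q h1 h2 h3 h4; omega) e o2
    · exact key (by ring) (by ring) ht0 hb0 ha0 hs0
        (fun q h1 h2 h3 h4 => by have := heven q h1 h2 h3 h4; omega) e o3
  have heven3 : ∀ q : ℕ, q.Prime → q ≠ 2 → q ≠ p → expo q b % 2 = 0 ∧ expo q a % 2 = 0 ∧
      expo q (a - b) % 2 = 0 ∧ expo q (a + b) % 2 = 0 ∧ expo q (a - 2 * b) % 2 = 0 ∧
      expo q (a + 2 * b) % 2 = 0 := by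
    intro q hq q2 qp
    by_cases q3 : q = 3
    · subst q3; exact h3'
    · exact heven q hq q2 q3 qp
  have hple := expo_sum_mod_two_le_one hp (by omega) (by omega) hab
  have hdvd : ∀ x : ℤ, expo p x % 2 = 1 → (p : ℤ) ∣ x := by
    intro x hx
    by_contra hx'
    rw [expo_eq_zero hx'] at hx
    omega
  have hsq : ∀ x : ℤ, x ≠ 0 → expo p x % 2 = 0 →
      (∀ q : ℕ, q.Prime → q ≠ 2 → q ≠ p → expo q x % 2 = 0) → IsSquare (x : ZMod p) := by
    intro x hx hxp hxq
    refine isSquare_zmod_of_expo hp hmod hx fun q hq q2 => ?_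
    by_cases qp : q = p
    · rw [qp]; exact hxp
    · exact hxq q hq q2 qp
  have hb := fun q h1 h2 h3 => (heven3 q h1 h2 h3).1
  have ha := fun q h1 h2 h3 => (heven3 q h1 h2 h3).2.1
  have hm := fun q h1 h2 h3 => (heven3 q h1 h2 h3).2.2.1
  have ht := fun q h1 h2 h3 => (heven3 q h1 h2 h3).2.2.2.1
  have hr := fun q h1 h2 h3 => (heven3 q h1 h2 h3).2.2.2.2.1
  have hs := fun q h1 h2 h3 => (heven3 q h1 h2 h3).2.2.2.2.2
  have hpm : expo p (a - b) % 2 = 0 := by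
    by_contra ho
    have hd := hdvd (a - b) (by omega)
    have hpb := dvd_of_isSquare_of_dvd_three_mul hp hmod (hsq b hb0 (by omega) hb)
      (hsq _ hs0 (by omega) hs) (Or.inl (by rwa [show a + 2 * b - 3 * b = a - b by ring]))
    exact habp ((dvd_sub_left hpb).1 hd) hpb
  have hpt : expo p (a + b) % 2 = 0 := by
    by_contra ho
    have hd := hdvd (a + b) (by omega)
    have hpb := dvd_of_isSquare_of_dvd_three_mul hp hmod (hsq b hb0 (by omega) hb)
      (hsq _ hr0 (by omega) hr) (Or.inr (by rwa [show a - 2 * b + 3 * b = a + b by ring]))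
    exact habp ((dvd_add_left hpb).1 hd) hpb
  have hpr : expo p (a - 2 * b) % 2 = 0 := by
    by_contra ho
    have hd := hdvd (a - 2 * b) (by omega)
    have hpb := dvd_of_isSquare_of_dvd_three_mul hp hmod (hsq b hb0 (by omega) hb)
      (hsq _ ht0 (by omega) ht) (Or.inl (by rwa [show a + b - 3 * b = a - 2 * b by ring]))
    exact habp ((dvd_sub_left (hpb.mul_left 2)).1 hd) hpb
  have hps : expo p (a + 2 * b) % 2 = 0 := by
    by_contra ho
    have hd := hdvd (a + 2 * b) (by omega)
    have hpb := dvd_of_isSquare_of_dvd_three_mul hp hmod (hsq b hb0 (by omega) hb)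
      (hsq _ hm0 (by omega) hm) (Or.inr (by rwa [show a - b + 3 * b = a + 2 * b by ring]))
    exact habp ((dvd_add_left (hpb.mul_left 2)).1 hd) hpb
  have hall : ∀ x : ℤ, expo p x % 2 = 0 →
      (∀ q : ℕ, q.Prime → q ≠ 2 → q ≠ p → expo q x % 2 = 0) →
      ∀ q : ℕ, q.Prime → q ≠ 2 → expo q x % 2 = 0 := by
    intro x hxp hxq q hq q2
    by_cases qp : q = p
    · rw [qp]; exact hxp
    · exact hxq q hq q2 qp
  have h8 := fun {x : ℤ} => emod_eight_of_odd (x := x) hp hmod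
  have hprod := fun {x y : ℤ} => exists_mul_eq_sq_of_emod_eight_eq (x := x) (y := y) hp hmod
  clear hsum heven heven3 h3' hsq hdvd hple htwo
  rcases Int.emod_two_eq_zero_or_one a with ha2 | ha2
  · obtain ⟨c, rfl⟩ : (2 : ℤ) ∣ a := Int.dvd_of_emod_eq_zero ha2
    have hb2 : b % 2 = 1 := by omega
    have b8 := h8 hb2 hb
    have m8 := h8 (x := 2 * c - b) (by omega) hm
    have t8 := h8 (x := 2 * c + b) (by omega) ht
    have hc2 : c % 2 = 0 := by omega
    have htwo : ∀ q x, q.Prime → q ≠ 2 → x ≠ 0 → expo q (2 * x) = expo q x := by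
      intro q x hq q2 hx
      rw [expo_mul q two_ne_zero hx, show (2 : ℤ) = (2 : ℕ) by rfl, expo_prime Nat.prime_two,
        if_neg q2.symm, zero_add]
    rw [show 2 * c - 2 * b = 2 * (c - b) by ring] at hr hpr hr0
    rw [show 2 * c + 2 * b = 2 * (c + b) by ring] at hs hps hs0
    have hr' : ∀ q : ℕ, q.Prime → q ≠ 2 → expo q (c - b) % 2 = 0 := fun q hq q2 => by
      rw [← htwo q _ hq q2 (right_ne_zero_of_mul hr0)]
      exact hall _ hpr hr q hq q2
    have hs' : ∀ q : ℕ, q.Prime → q ≠ 2 → expo q (c + b) % 2 = 0 := fun q hq q2 => by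
      rw [← htwo q _ hq q2 (right_ne_zero_of_mul hs0)]
      exact hall _ hps hs q hq q2
    have s8 := h8 (x := c + b) (by omega) fun q hq q2 _ => hs' q hq q2
    have r8 := h8 (x := c - b) (by omega) fun q hq q2 _ => hr' q hq q2
    obtain ⟨e, he⟩ := hprod (x := -(c - b)) (y := c + b) (by omega) (by omega)
      (fun q hq q2 => by rw [expo_neg]; exact hr' q hq q2) hs'
    obtain ⟨f, hf⟩ := hprod (x := -(2 * c - b)) (y := 2 * c + b) (by omega) (by omega)
      (fun q hq q2 => by rw [expo_neg]; exact hall _ hpm hm q hq q2) (hall _ hpt ht)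
    have hc0 := eq_zero_of_sq_sub_sq_of_sq_sub_four_mul_sq (e := e) (f := f)
      (hab.of_isCoprime_of_dvd_left (Dvd.intro_left _ rfl)).symm
      (by linear_combination he) (by linear_combination hf)
    exact ha0 (by rw [hc0, mul_zero])
  · have a8 := h8 ha2 ha
    have r8 := h8 (x := a - 2 * b) (by omega) hr
    have s8 := h8 (x := a + 2 * b) (by omega) hs
    rcases Int.emod_two_eq_zero_or_one b with hb2 | hb2
    swap
    · have b8 := h8 hb2 hb
      omega
    have m8 := h8 (x := a - b) (by omega) hm
    have t8 := h8 (x := a + b) (by omega) ht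
    have hb4 : b % 4 = 0 := four_dvd_of_even_expo hp hmod hb0 hb2 fun q hq qp => by
      by_cases q2 : q = 2
      · have h1 := hz2 a ha2
        have h2 := hz2 (a - b) (by omega)
        have h3 := hz2 (a + b) (by omega)
        have h4 := hz2 (a - 2 * b) (by omega)
        have h5 := hz2 (a + 2 * b) (by omega)
        rw [q2]
        omega
      · exact hb q hq q2 qp
    obtain ⟨e, he⟩ := hprod (x := a - b) (y := a + b) (by omega) (by omega)
      (hall _ hpm hm) (hall _ hpt ht)
    obtain ⟨f, hf⟩ := hprod (x := a - 2 * b) (y := a + 2 * b) (by omega) (by omega)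
      (hall _ hpr hr) (hall _ hps hs)
    exact hb0 (eq_zero_of_sq_sub_sq_of_sq_sub_four_mul_sq (e := e) (f := f) hab
      (by linear_combination he) (by linear_combination hf))

/-- For a prime `p ≡ 17 (mod 24)` such that `2` is not a fourth power modulo `p`
(equivalently, `p` does not split completely in `ℚ(2^{1/4})`), every rational point on
`C_p : y² = x(x² − p²)(x² − 4p²)` satisfies `y = 0`, hence `x ∈ {0, ±p, ±2p}`. -/
theorem rational_points_Cp_of_seventeen_mod_24 (p : ℕ) (hp : Nat.Prime p) (hmod : p % 24 = 17)
    (h2 : ¬∃ z : ZMod p, z ^ 4 = 2)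
    (x y : ℚ) (h : y ^ 2 = x * (x ^ 2 - (p : ℚ) ^ 2) * (x ^ 2 - 4 * (p : ℚ) ^ 2)) :
    y = 0 ∧ (x = 0 ∨ x = p ∨ x = -p ∨ x = 2 * p ∨ x = -(2 * p)) := by
  have hp0 : (p : ℚ) ≠ 0 := Nat.cast_ne_zero.2 hp.ne_zero
  have hy : y = 0 := by
    obtain ⟨t, rfl⟩ : ∃ t : ℚ, x = p * t := ⟨x / p, by field_simp⟩
    have hd0 : (t.den : ℚ) ≠ 0 := Nat.cast_ne_zero.2 t.den_ne_zero
    have htd : t * t.den = t.num := Rat.mul_den_eq_num t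
    have hsq : (y * t.den ^ 3 / p ^ 2) ^ 2 = ((p * (t.den * t.num * (t.num - t.den) *
        (t.num + t.den) * (t.num - 2 * t.den) * (t.num + 2 * t.den)) : ℤ) : ℚ) := by
      push_cast
      rw [← htd, div_pow, mul_pow, h]
      field_simp
      ring
    obtain ⟨w, hw⟩ := Rat.isSquare_intCast_iff.1 ⟨_, hsq.symm.trans (pow_two _)⟩
    have hw0 := mul_six_forms_ne_sq hp hmod (Rat.isCoprime_num_den t) (hw.trans (pow_two w).symm)
    rw [hw, hw0] at hsq
    simpa [hd0, hp0] using hsq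
  refine ⟨hy, ?_⟩
  have hfac : x * ((x - p) * ((x + p) * ((x - 2 * p) * (x + 2 * p)))) = 0 := by
    rw [hy] at h
    linear_combination -h
  simp only [mul_eq_zero] at hfac
  rcases hfac with h | h | h | h | h
  · exact Or.inl h
  · exact Or.inr (Or.inl (by linarith))
  · exact Or.inr (Or.inr (Or.inl (by linarith)))
  · exact Or.inr (Or.inr (Or.inr (Or.inl (by linarith))))
  · exact Or.inr (Or.inr (Or.inr (Or.inr (by linarith))))
end
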